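/- arXiv:1811.01000 — 4 statements merged into one kernel-verified Lean document; each statement's English description precedes it below -/
import Mathlib

section
/- Let k be an algebraically closed field, let A, B, C be finite-dimensional k-algebras, let 𝓕: D^b(A) → D^b(B) be a perverse equivalence with respect to the perversity datum (r, q, 𝒮, 𝒮'), and let 𝓖: D^b(B) → D^b(C) be a perverse equivalence with respect to the perversity datum (r, q', 𝒮', 𝒮''). Then the composition 𝓖 ∘ 𝓕: D^b(A) → D^b(C) is a perverse equivalence with respect to the perversity datum (r, q + q', 𝒮, 𝒮''). -/
open CategoryTheory

universe u

attribute [local instance] HasDerivedCategory.standard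

/-- `U` is a composition factor of the module `M`, i.e. `U` is simple and is isomorphic
to a subquotient `N'/N` of `M`. -/
def IsCompositionFactor (A : Type u) [Ring A] (U M : ModuleCat.{u} A) : Prop :=
  IsSimpleModule A U ∧
    ∃ (N N' : Submodule A M), N ≤ N' ∧
      Nonempty ((↥N' ⧸ Submodule.comap N'.subtype N) ≃ₗ[A] ↥U)

/-- `S` is a filtration `∅ = S₋₁ ⊆ S₀ ⊆ ⋯ ⊆ S_r = 𝒮_A` whose top term is a set of
representatives of the isomorphism classes of simple `A`-modules. -/
def IsSimplesFiltration (A : Type u) [Ring A] (r : ℕ) (S : ℤ → Set (ModuleCat.{u} A)) : Prop :=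
  (∀ i j : ℤ, i ≤ j → S i ⊆ S j) ∧
  (∀ i : ℤ, i < 0 → S i = ∅) ∧
  (∀ i : ℤ, ∀ V ∈ S i, IsSimpleModule A V) ∧
  (∀ V : ModuleCat.{u} A, IsSimpleModule A V → ∃ W ∈ S (r : ℤ), Nonempty (V ≅ W)) ∧
  (∀ W ∈ S (r : ℤ), ∀ W' ∈ S (r : ℤ), Nonempty (W ≅ W') → W = W')

/-- The perversity condition for a functor `D^b(A) ⥤ D^b(B)` with respect to the perversity
datum `(r, q, S, S')`: `S` and `S'` are filtrations as above and, whenever `T ∈ Sᵢ \ Sᵢ₋₁`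
(`0 ≤ i ≤ r`), the composition factors of `H^{-j}(F(T))` lie in `S'ᵢ` for `j = q i` and in
`S'ᵢ₋₁` for `j ≠ q i`. -/
def IsPerverse {A B : Type u} [Ring A] [Ring B]
    (F : DerivedCategory (ModuleCat.{u} A) ⥤ DerivedCategory (ModuleCat.{u} B))
    (r : ℕ) (q : ℤ → ℤ) (S : ℤ → Set (ModuleCat.{u} A)) (S' : ℤ → Set (ModuleCat.{u} B)) :
    Prop :=
  IsSimplesFiltration A r S ∧ IsSimplesFiltration B r S' ∧
    ∀ i : ℤ, 0 ≤ i → i ≤ (r : ℤ) → ∀ T ∈ S i, T ∉ S (i - 1) →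
      ∀ j : ℤ, ∀ U : ModuleCat.{u} B,
        IsCompositionFactor B U
          ((DerivedCategory.homologyFunctor (ModuleCat.{u} B) (-j)).obj
            (F.obj ((DerivedCategory.singleFunctor (ModuleCat.{u} A) 0).obj T))) →
        ∃ W ∈ S' (if j = q i then i else i - 1), Nonempty (U ≅ W)

/-- An equivalence of triangulated categories: the functor commutes with the shift and is
triangulated. -/
def IsTriangulatedEquiv {A B : Type u} [Ring A] [Ring B]
    (F : DerivedCategory (ModuleCat.{u} A) ≌ DerivedCategory (ModuleCat.{u} B)) : Prop :=
  ∃ _ : F.functor.CommShift ℤ, F.functor.IsTriangulated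

section CompositionFactors

variable {R : Type u} [Ring R]

/-- No subquotient of `M` maps nontrivially to a submodule of `U`. -/
def HasNoSubquotientIn (R : Type u) [Ring R] (U M : Type u) [AddCommGroup U] [Module R U]
    [AddCommGroup M] [Module R M] : Prop :=
  ∀ (P : Submodule R M) (φ : P →ₗ[R] U), φ = 0

namespace HasNoSubquotientIn

variable {U X Y Z : Type u} [AddCommGroup U] [Module R U] [AddCommGroup X] [Module R X]
  [AddCommGroup Y] [Module R Y] [AddCommGroup Z] [Module R Z]

lemma of_exact (hX : HasNoSubquotientIn R U X) (hZ : HasNoSubquotientIn R U Z)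
    (f : X →ₗ[R] Y) (g : Y →ₗ[R] Z) (h : LinearMap.ker g ≤ LinearMap.range f) :
    HasNoSubquotientIn R U Y := by
  intro P φ
  have hφ : ∀ p : P, g p = 0 → φ p = 0 := by
    intro p hp
    obtain ⟨x, hx⟩ := h hp
    have hxP : x ∈ P.comap f := by simp [hx]
    have h0 := LinearMap.congr_fun
      (hX (P.comap f) (φ.comp (f.restrict (p := P.comap f) (q := P) fun _ hy => hy))) ⟨x, hxP⟩
    have he : f.restrict (p := P.comap f) (q := P) (fun _ hy => hy) ⟨x, hxP⟩ = p :=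
      Subtype.ext hx
    simpa [he] using h0
  let γ : P →ₗ[R] P.map g := g.restrict fun y hy => Submodule.mem_map_of_mem hy
  have hγ : Function.Surjective γ := by
    rintro ⟨_, y, hy, rfl⟩
    exact ⟨⟨y, hy⟩, rfl⟩
  have hker : LinearMap.ker γ ≤ LinearMap.ker φ := fun p hp => hφ p (congrArg Subtype.val hp)
  let ψ : P.map g →ₗ[R] U :=
    ((LinearMap.ker γ).liftQ φ hker).comp (γ.quotKerEquivOfSurjective hγ).symm.toLinearMap
  ext p
  have h0 := LinearMap.congr_fun (hZ _ ψ) (γ p)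
  have he : (γ.quotKerEquivOfSurjective hγ).symm (γ p) = Submodule.Quotient.mk p :=
    (LinearEquiv.symm_apply_eq _).2 rfl
  simpa [ψ, he] using h0

lemma of_subsingleton [Subsingleton X] : HasNoSubquotientIn R U X := by
  intro P φ
  ext p
  rw [Subsingleton.elim p 0, map_zero, LinearMap.zero_apply]

lemma of_injective (hY : HasNoSubquotientIn R U Y) (f : X →ₗ[R] Y) (hf : Function.Injective f) :
    HasNoSubquotientIn R U X :=
  of_exact (X := PUnit) of_subsingleton hY 0 f (by rw [LinearMap.ker_eq_bot.2 hf]; exact bot_le)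

lemma of_surjective (hX : HasNoSubquotientIn R U X) (f : X →ₗ[R] Y)
    (hf : Function.Surjective f) : HasNoSubquotientIn R U Y :=
  of_exact (Z := PUnit) hX of_subsingleton f 0 (by rw [LinearMap.range_eq_top.2 hf]; exact le_top)

lemma sup {M : Type u} [AddCommGroup M] [Module R M] {P Q : Submodule R M}
    (hP : HasNoSubquotientIn R U P) (hQ : HasNoSubquotientIn R U Q) :
    HasNoSubquotientIn R U (P ⊔ Q : Submodule R M) := by
  have hQ' : HasNoSubquotientIn R U (Q.map P.mkQ) :=
    hQ.of_surjective (P.mkQ.restrict fun y hy => Submodule.mem_map_of_mem hy) (by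
      rintro ⟨_, y, hy, rfl⟩
      exact ⟨⟨y, hy⟩, rfl⟩)
  refine of_exact hP hQ' (Submodule.inclusion le_sup_left)
    (P.mkQ.restrict (p := P ⊔ Q) (q := Q.map P.mkQ) fun y hy => ?_) ?_
  · obtain ⟨a, ha, b, hb, rfl⟩ := Submodule.mem_sup.1 hy
    refine ⟨b, hb, ?_⟩
    have : P.mkQ a = 0 := by simpa using ha
    rw [map_add, this, zero_add]
  · rintro ⟨y, hy⟩ h
    have h' : P.mkQ y = 0 := congrArg Subtype.val h
    rw [Submodule.mkQ_apply, Submodule.Quotient.mk_eq_zero] at h'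
    exact ⟨⟨y, h'⟩, rfl⟩

lemma of_iSup_range_eq_top {J : Type*} {N : J → Type u} [∀ j, AddCommGroup (N j)]
    [∀ j, Module R (N j)] (hN : ∀ j, HasNoSubquotientIn R U (N j)) (f : ∀ j, N j →ₗ[R] X)
    (hf : ⨆ j, LinearMap.range (f j) = ⊤) : HasNoSubquotientIn R U X := by
  have key : ∀ x : X, ∃ Q : Submodule R X, HasNoSubquotientIn R U Q ∧ x ∈ Q := by
    intro x
    have hx : x ∈ ⨆ j, LinearMap.range (f j) := hf ▸ Submodule.mem_top
    induction hx using Submodule.iSup_induction' with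
    | mem j x hx =>
      exact ⟨_, (hN j).of_surjective (f j).rangeRestrict (f j).surjective_rangeRestrict, hx⟩
    | zero => exact ⟨⊥, of_subsingleton, Submodule.zero_mem _⟩
    | add x y _ _ hx hy =>
      obtain ⟨P, hP, hxP⟩ := hx
      obtain ⟨Q, hQ, hyQ⟩ := hy
      exact ⟨P ⊔ Q, hP.sup hQ, Submodule.add_mem_sup hxP hyQ⟩
  intro P φ
  ext ⟨p, hp⟩
  obtain ⟨Q, hQ, hpQ⟩ := key p
  exact LinearMap.congr_fun
    (hQ _ (φ.comp (Q.subtype.restrict (p := P.comap Q.subtype) (q := P) fun _ hy => hy)))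
    ⟨⟨p, hpQ⟩, hp⟩

end HasNoSubquotientIn

lemma isCompositionFactor_iff (U M : ModuleCat.{u} R) :
    IsCompositionFactor R U M ↔ IsSimpleModule R U ∧ ¬ HasNoSubquotientIn R U M := by
  refine and_congr_right fun hU => ⟨?_, fun h => ?_⟩
  · rintro ⟨N, N', _, ⟨e⟩⟩ h
    have h0 := h N' (e.toLinearMap.comp (Submodule.mkQ _))
    have := IsSimpleModule.nontrivial R U
    obtain ⟨y, hy⟩ := exists_ne (0 : U)
    obtain ⟨x, hx⟩ := Submodule.mkQ_surjective _ (e.symm y)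
    apply hy
    have h1 := LinearMap.congr_fun h0 x
    rw [LinearMap.comp_apply, hx] at h1
    simpa using h1
  · simp only [HasNoSubquotientIn, not_forall] at h
    obtain ⟨P, φ, hφ⟩ := h
    have hs : Function.Surjective φ := LinearMap.surjective_of_ne_zero hφ
    refine ⟨(LinearMap.ker φ).map P.subtype, P, Submodule.map_subtype_le _ _, ⟨?_⟩⟩
    exact (Submodule.quotEquivOfEq _ _
      (Submodule.comap_map_eq_of_injective P.injective_subtype _)).trans
        (φ.quotKerEquivOfSurjective hs)

/-- All composition factors of `M` are isomorphic to a member of `S`. -/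
def FactorsIn (S : Set (ModuleCat.{u} R)) (M : ModuleCat.{u} R) : Prop :=
  ∀ U : ModuleCat.{u} R, IsCompositionFactor R U M → ∃ W ∈ S, Nonempty (U ≅ W)

lemma factorsIn_iff (S : Set (ModuleCat.{u} R)) (M : ModuleCat.{u} R) :
    FactorsIn S M ↔ ∀ U : ModuleCat.{u} R, IsSimpleModule R U →
      (¬ ∃ W ∈ S, Nonempty (U ≅ W)) → HasNoSubquotientIn R U M := by
  simp only [FactorsIn, isCompositionFactor_iff]
  exact forall_congr' fun U => by rw [and_imp, not_imp_comm (b := HasNoSubquotientIn R U M)]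

namespace FactorsIn

variable {S : Set (ModuleCat.{u} R)}

lemma mono {S' : Set (ModuleCat.{u} R)} {M : ModuleCat.{u} R} (hM : FactorsIn S M)
    (h : S ⊆ S') : FactorsIn S' M := fun U hU =>
  let ⟨W, hW, e⟩ := hM U hU
  ⟨W, h hW, e⟩

lemma of_exact {T : ShortComplex (ModuleCat.{u} R)} (hT : T.Exact) (h₁ : FactorsIn S T.X₁)
    (h₃ : FactorsIn S T.X₃) : FactorsIn S T.X₂ := by
  rw [factorsIn_iff] at *
  exact fun U hU hUS => (h₁ U hU hUS).of_exact (h₃ U hU hUS) T.f.hom T.g.hom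
    hT.moduleCat_range_eq_ker.ge

lemma of_injective {M N : ModuleCat.{u} R} (hN : FactorsIn S N) (f : M →ₗ[R] N)
    (hf : Function.Injective f) : FactorsIn S M := by
  rw [factorsIn_iff] at *
  exact fun U hU hUS => (hN U hU hUS).of_injective f hf

lemma of_surjective {M N : ModuleCat.{u} R} (hM : FactorsIn S M) (f : M →ₗ[R] N)
    (hf : Function.Surjective f) : FactorsIn S N := by
  rw [factorsIn_iff] at *
  exact fun U hU hUS => (hM U hU hUS).of_surjective f hf

lemma of_iso {M N : ModuleCat.{u} R} (hM : FactorsIn S M) (e : M ≅ N) : FactorsIn S N :=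
  hM.of_surjective e.toLinearEquiv.toLinearMap e.toLinearEquiv.surjective

lemma of_isZero {M : ModuleCat.{u} R} (hM : Limits.IsZero M) : FactorsIn S M := by
  have := ModuleCat.subsingleton_of_isZero hM
  rw [factorsIn_iff]
  exact fun _ _ _ => HasNoSubquotientIn.of_subsingleton

lemma of_iSup_range_eq_top {J : Type*} {N : J → ModuleCat.{u} R} {M : ModuleCat.{u} R}
    (hN : ∀ j, FactorsIn S (N j)) (f : ∀ j, N j ⟶ M)
    (hf : ⨆ j, LinearMap.range (f j).hom = ⊤) : FactorsIn S M := by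
  simp only [factorsIn_iff] at *
  exact fun U hU hUS =>
    HasNoSubquotientIn.of_iSup_range_eq_top (fun j => hN j U hU hUS) (fun j => (f j).hom) hf

end FactorsIn

end CompositionFactors

section Coproducts

open Limits HomologicalComplex

variable {R : Type u} [Ring R] {J : Type u}

lemma ModuleCat.iSup_range_eq_top_of_isColimit {M : J → ModuleCat.{u} R} {N : ModuleCat.{u} R}
    {i : ∀ j, M j ⟶ N} (h : IsColimit (Cofan.mk N i)) :
    ⨆ j, LinearMap.range (i j).hom = ⊤ := by
  rw [← Submodule.ker_mkQ (⨆ j, LinearMap.range (i j).hom), LinearMap.ker_eq_top]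
  have : ModuleCat.ofHom (Submodule.mkQ (⨆ j, LinearMap.range (i j).hom)) = 0 := by
    refine Cofan.IsColimit.hom_ext h _ _ fun j => ?_
    ext x
    simpa using (le_iSup (fun j => LinearMap.range (i j).hom) j) ⟨x, rfl⟩
  simpa using congrArg ModuleCat.Hom.hom this

open Classical in
/-- The projections of a coproduct onto its summands, in a category with zero morphisms. -/
noncomputable def cofanProj {C : Type*} [Category* C] [HasZeroMorphisms C] {J : Type*} {K : J → C}
    {L : C} {i : ∀ j, K j ⟶ L} (h : IsColimit (Cofan.mk L i)) (j : J) : L ⟶ K j :=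
  Cofan.IsColimit.desc h fun j' => if e : j' = j then eqToHom (congrArg K e) else 0

section

variable {C : Type*} [Category* C] [HasZeroMorphisms C] {J : Type*} {K : J → C}
    {L : C} {i : ∀ j, K j ⟶ L} (h : IsColimit (Cofan.mk L i))

lemma cofanProj_self (j : J) : i j ≫ cofanProj h j = 𝟙 _ := by
  classical
  have := Cofan.IsColimit.fac h
    (fun k => if e : k = j then eqToHom (congrArg K e) else 0) j
  rw [dif_pos rfl] at this
  exact this

lemma cofanProj_ne {j j' : J} (hj : j ≠ j') : i j ≫ cofanProj h j' = 0 := by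
  classical
  have := Cofan.IsColimit.fac h
    (fun k => if e : k = j' then eqToHom (congrArg K e) else 0) j
  rw [dif_neg hj] at this
  exact this

end

section Complexes

variable {K : J → CochainComplex (ModuleCat.{u} R) ℤ} {L : CochainComplex (ModuleCat.{u} R) ℤ}
  {i : ∀ j, K j ⟶ L} (h : IsColimit (Cofan.mk L i))

/-- Degreewise, a coproduct of complexes is a coproduct. -/
noncomputable def isColimitCofanMkX (n : ℤ) :
    IsColimit (Cofan.mk (L.X n) fun j => (i j).f n) :=
  isColimitCofanMkObjOfIsColimit (eval _ _ n) _ _ h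

include h in
lemma exists_sum_proj_X (n : ℤ) (x : L.X n) :
    ∃ s : Finset J, x = ∑ j ∈ s, (i j).f n ((cofanProj h j).f n x) := by
  classical
  have hx : x ∈ ⨆ j, LinearMap.range ((i j).f n).hom :=
    ModuleCat.iSup_range_eq_top_of_isColimit (isColimitCofanMkX h n) ▸ Submodule.mem_top
  have hself : ∀ (j) (y : (K j).X n), (cofanProj h j).f n ((i j).f n y) = y := fun j y => by
    have := congrArg (fun f => f.f n) (cofanProj_self h j)
    exact ConcreteCategory.congr_hom this y
  have hne : ∀ (j j') (_ : j ≠ j') (y : (K j).X n),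
      (cofanProj h j').f n ((i j).f n y) = 0 := fun j j' hj y => by
    have := congrArg (fun f => f.f n) (cofanProj_ne h hj)
    exact ConcreteCategory.congr_hom this y
  suffices H : ∃ s : Finset J, ∀ t, s ⊆ t →
      x = ∑ j ∈ t, (i j).f n ((cofanProj h j).f n x) from
    let ⟨s, hs⟩ := H
    ⟨s, hs s subset_rfl⟩
  induction hx using Submodule.iSup_induction' with
  | mem j x hx =>
    obtain ⟨y, rfl⟩ := hx
    refine ⟨{j}, fun t ht => ?_⟩
    rw [Finset.sum_eq_single j]
    · exact congrArg _ (hself j y).symm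
    · intro j' _ hj'
      exact (congrArg _ (hne j j' hj'.symm y)).trans (map_zero _)
    · exact fun hj => (hj (ht (Finset.mem_singleton_self j))).elim
  | zero => exact ⟨∅, fun t _ => by simp⟩
  | add x y _ _ hx hy =>
    obtain ⟨s, hs⟩ := hx
    obtain ⟨t, ht⟩ := hy
    refine ⟨s ∪ t, fun t' h' => ?_⟩
    simp only [map_add, Finset.sum_add_distrib]
    rw [← hs _ (Finset.union_subset_left h'), ← ht _ (Finset.union_subset_right h')]

include h in
lemma exists_sum_proj_homology (n : ℤ) (x : L.homology n) :
    ∃ s : Finset J, x = ∑ j ∈ s,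
      homologyMap (i j) n (homologyMap (cofanProj h j) n x) := by
  obtain ⟨z, rfl⟩ := (ModuleCat.epi_iff_surjective (L.homologyπ n)).1 inferInstance x
  obtain ⟨s, hs⟩ := exists_sum_proj_X h n (L.iCycles n z)
  refine ⟨s, ?_⟩
  have hz : z = ∑ j ∈ s, cyclesMap (i j) n (cyclesMap (cofanProj h j) n z) := by
    apply (ModuleCat.mono_iff_injective (L.iCycles n)).1 inferInstance
    rw [map_sum]
    refine hs.trans (Finset.sum_congr rfl fun j _ => ?_)
    have h₁ := ConcreteCategory.congr_hom (cyclesMap_i (cofanProj h j) n) z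
    have h₂ := ConcreteCategory.congr_hom (cyclesMap_i (i j) n)
      (cyclesMap (cofanProj h j) n z)
    simp only [ConcreteCategory.comp_apply] at h₁ h₂
    rw [h₂, h₁]
  conv_lhs => rw [hz, map_sum]
  refine Finset.sum_congr rfl fun j _ => ?_
  have h₁ := ConcreteCategory.congr_hom (homologyπ_naturality (cofanProj h j) n) z
  have h₂ := ConcreteCategory.congr_hom (homologyπ_naturality (i j) n)
    (cyclesMap (cofanProj h j) n z)
  simp only [ConcreteCategory.comp_apply] at h₁ h₂
  rw [h₁, h₂]

variable {K' : J → CochainComplex (ModuleCat.{u} R) ℤ} {L' : CochainComplex (ModuleCat.{u} R) ℤ}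
  {i' : ∀ j, K' j ⟶ L'}

include h in
lemma quasiIso_of_isColimit (h' : IsColimit (Cofan.mk L' i')) (s : ∀ j, K j ⟶ K' j)
    [∀ j, QuasiIso (s j)] (f : L ⟶ L') (hf : ∀ j, i j ≫ f = s j ≫ i' j) : QuasiIso f := by
  have hp : ∀ j, f ≫ cofanProj h' j = cofanProj h j ≫ s j := by
    refine fun j => Cofan.IsColimit.hom_ext h _ _ fun j' => ?_
    change i j' ≫ _ = i j' ≫ _
    rw [reassoc_of% hf]
    by_cases hj : j' = j
    · subst hj
      rw [cofanProj_self, reassoc_of% cofanProj_self h j', Category.comp_id]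
    · rw [cofanProj_ne _ hj, ← Category.assoc, cofanProj_ne _ hj, comp_zero, zero_comp]
  have hfH : ∀ n j y, homologyMap f n (homologyMap (i j) n y) =
      homologyMap (i' j) n (homologyMap (s j) n y) := fun n j y => by
    simpa only [homologyMap_comp, ConcreteCategory.comp_apply] using
      ConcreteCategory.congr_hom (congrArg (homologyMap · n) (hf j)) y
  have hpH : ∀ n j y, homologyMap (cofanProj h' j) n (homologyMap f n y) =
      homologyMap (s j) n (homologyMap (cofanProj h j) n y) := fun n j y => by
    simpa only [homologyMap_comp, ConcreteCategory.comp_apply] using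
      ConcreteCategory.congr_hom (congrArg (homologyMap · n) (hp j)) y
  have hs : ∀ n j, Function.Bijective (homologyMap (s j) n) := fun n j =>
    ConcreteCategory.bijective_of_isIso _
  rw [quasiIso_iff]
  intro n
  rw [quasiIsoAt_iff_isIso_homologyMap, ConcreteCategory.isIso_iff_bijective]
  constructor
  · rw [injective_iff_map_eq_zero]
    intro x hx
    obtain ⟨t, ht⟩ := exists_sum_proj_homology h n x
    rw [ht]
    refine Finset.sum_eq_zero fun j _ => ?_
    have : homologyMap (cofanProj h j) n x = 0 := (hs n j).1 (by rw [← hpH, hx, map_zero, map_zero])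
    rw [this, map_zero]
  · intro y
    obtain ⟨t, ht⟩ := exists_sum_proj_homology h' n y
    choose g hg using fun j => (hs n j).2 (homologyMap (cofanProj h' j) n y)
    refine ⟨∑ j ∈ t, homologyMap (i j) n (g j), ?_⟩
    rw [map_sum]
    exact Eq.trans (Finset.sum_congr rfl fun j _ => by rw [hfH, hg]) ht.symm

end Complexes

end Coproducts

section DerivedCoproducts

open Limits Pretriangulated DerivedCategory

variable {R : Type u} [Ring R] {J : Type u}

section Complexes

variable {K : J → CochainComplex (ModuleCat.{u} R) ℤ} {L : CochainComplex (ModuleCat.{u} R) ℤ}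
  {i : ∀ j, K j ⟶ L} (h : IsColimit (Cofan.mk L i))

include h

lemma iSup_range_homologyFunctor_Q (n : ℤ) :
    ⨆ j, LinearMap.range ((homologyFunctor (ModuleCat.{u} R) n).map (Q.map (i j))).hom = ⊤ := by
  rw [eq_top_iff]
  rintro x -
  let e := (homologyFunctorFactors (ModuleCat.{u} R) n)
  obtain ⟨s, hs⟩ := exists_sum_proj_homology h n (e.hom.app L x)
  have hx : x = ∑ j ∈ s, (homologyFunctor (ModuleCat.{u} R) n).map (Q.map (i j))
      (e.inv.app _ (HomologicalComplex.homologyMap (cofanProj h j) n (e.hom.app L x))) := by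
    have h1 : x = e.inv.app L (e.hom.app L x) := by
      rw [← ConcreteCategory.comp_apply, Iso.hom_inv_id_app]
      rfl
    refine h1.trans ((congrArg _ hs).trans ((map_sum (e.inv.app L).hom _ s).trans
      (Finset.sum_congr rfl fun j _ => ?_)))
    exact (ConcreteCategory.congr_hom (e.inv.naturality (i j)) _)
  rw [hx]
  exact Submodule.sum_mem _ fun j _ => Submodule.mem_iSup_of_mem j ⟨_, rfl⟩

lemma exists_desc_Q {Y : DerivedCategory (ModuleCat.{u} R)} (f : ∀ j, Q.obj (K j) ⟶ Y) :
    ∃ g : Q.obj L ⟶ Y, ∀ j, Q.map (i j) ≫ g = f j := by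
  let e := Q.objObjPreimageIso Y
  choose K' s hs g hg using fun j => right_fac (f j ≫ e.inv)
  have : ∀ j, QuasiIso (s j) := fun j => by rw [← isIso_Q_map_iff_quasiIso]; exact hs j
  let c := coproductIsCoproduct K'
  let t : (∐ K') ⟶ L := Cofan.IsColimit.desc c fun j => s j ≫ i j
  have ht : ∀ j, Sigma.ι K' j ≫ t = s j ≫ i j := Cofan.IsColimit.fac c _
  have : QuasiIso t := quasiIso_of_isColimit c h s t ht
  refine ⟨inv (Q.map t) ≫ Q.map (Sigma.desc g) ≫ e.hom, fun j => ?_⟩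
  have h1 : Q.map (i j) ≫ inv (Q.map t) = inv (Q.map (s j)) ≫ Q.map (Sigma.ι K' j) := by
    rw [IsIso.comp_inv_eq, Category.assoc, IsIso.eq_inv_comp, ← Q.map_comp, ← Q.map_comp, ht]
  have h2 : Q.map (Sigma.ι K' j) ≫ Q.map (Sigma.desc g) = Q.map (g j) := by
    rw [← Q.map_comp, Sigma.ι_desc]
  rw [reassoc_of% h1, reassoc_of% h2, ← Category.assoc, ← hg, Category.assoc, e.inv_hom_id,
    Category.comp_id]

lemma eq_zero_of_Q_map_comp_eq_zero {Y : DerivedCategory (ModuleCat.{u} R)} (f : Q.obj L ⟶ Y)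
    (hf : ∀ j, Q.map (i j) ≫ f = 0) : f = 0 := by
  obtain ⟨E, e, w, hT⟩ := distinguished_cocone_triangle₁ f
  have hef : e ≫ f = 0 := comp_distTriang_mor_zero₁₂ _ hT
  have hE : ∀ j, ∃ l : Q.obj (K j) ⟶ E, Q.map (i j) = l ≫ e := fun j =>
    Triangle.coyoneda_exact₂ _ hT (Q.map (i j)) (hf j)
  choose l hl using hE
  obtain ⟨s, hs⟩ := exists_desc_Q h l
  have hse : ∀ j, Q.map (i j) ≫ s ≫ e = Q.map (i j) := fun j => by
    rw [reassoc_of% hs]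
    exact (hl j).symm
  have : IsIso (s ≫ e) := by
    rw [DerivedCategory.isIso_iff]
    intro n
    have : (homologyFunctor (ModuleCat.{u} R) n).map (s ≫ e) = 𝟙 _ := by
      ext x
      have hx : x ∈ LinearMap.eqLocus
          ((homologyFunctor (ModuleCat.{u} R) n).map (s ≫ e)).hom LinearMap.id := by
        have htop := iSup_range_homologyFunctor_Q h n
        refine (eq_top_iff.1 htop).trans (iSup_le fun j => ?_) Submodule.mem_top
        rintro _ ⟨y, rfl⟩
        have := congrArg ((homologyFunctor (ModuleCat.{u} R) n).map) (hse j)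
        rw [Functor.map_comp] at this
        exact ConcreteCategory.congr_hom this y
      exact hx
    rw [this]
    infer_instance
  rw [← cancel_epi (s ≫ e), Category.assoc, hef, comp_zero, comp_zero]

/-- The localization functor from complexes to the derived category preserves coproducts. -/
noncomputable def isColimitCofanMkQ :
    IsColimit (Cofan.mk (Q.obj L) fun j => Q.map (i j)) :=
  Cofan.IsColimit.mk _ (fun t => (exists_desc_Q h t.inj).choose)
    (fun t => (exists_desc_Q h t.inj).choose_spec) fun t m hm => by
      rw [← sub_eq_zero]
      refine eq_zero_of_Q_map_comp_eq_zero h _ fun j => ?_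
      rw [Preadditive.comp_sub, (exists_desc_Q h t.inj).choose_spec, sub_eq_zero]
      exact hm j

end Complexes

lemma DerivedCategory.iSup_range_homologyFunctor_of_isColimit
    {Y : J → DerivedCategory (ModuleCat.{u} R)} {Z : DerivedCategory (ModuleCat.{u} R)}
    {i : ∀ j, Y j ⟶ Z} (h : IsColimit (Cofan.mk Z i)) (n : ℤ) :
    ⨆ j, LinearMap.range ((homologyFunctor (ModuleCat.{u} R) n).map (i j)).hom = ⊤ := by
  let K : J → CochainComplex (ModuleCat.{u} R) ℤ := fun j => Q.objPreimage (Y j)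
  let e : ∀ j, Q.obj (K j) ≅ Y j := fun j => Q.objObjPreimageIso (Y j)
  let c := coproductIsCoproduct K
  obtain ⟨g, hg⟩ := exists_desc_Q c fun j => (e j).hom ≫ i j
  let g' : Z ⟶ Q.obj (∐ K) := Cofan.IsColimit.desc h fun j => (e j).inv ≫ Q.map (Sigma.ι K j)
  have hg' : ∀ j, i j ≫ g' = (e j).inv ≫ Q.map (Sigma.ι K j) := Cofan.IsColimit.fac h _
  have hgg : g' ≫ g = 𝟙 _ := by
    refine Cofan.IsColimit.hom_ext h _ _ fun j => ?_
    change i j ≫ _ = i j ≫ _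
    rw [reassoc_of% hg', Category.comp_id]
    erw [hg]
    rw [Iso.inv_hom_id_assoc]
  have hH : Epi ((homologyFunctor (ModuleCat.{u} R) n).map g) := by
    have : Epi g := (SplitEpi.mk g' hgg).epi
    exact ((SplitEpi.mk g' hgg).map _).epi
  rw [eq_top_iff]
  rintro x -
  obtain ⟨y, rfl⟩ := (ModuleCat.epi_iff_surjective _).1 hH x
  have hy : y ∈ Submodule.comap ((homologyFunctor (ModuleCat.{u} R) n).map g).hom
      (⨆ j, LinearMap.range ((homologyFunctor (ModuleCat.{u} R) n).map (i j)).hom) := by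
    refine (eq_top_iff.1 (iSup_range_homologyFunctor_Q c n)).trans (iSup_le fun j => ?_)
      Submodule.mem_top
    rintro _ ⟨z, rfl⟩
    refine Submodule.mem_iSup_of_mem j
      ⟨(homologyFunctor (ModuleCat.{u} R) n).map (e j).hom z, ?_⟩
    have := congrArg ((homologyFunctor (ModuleCat.{u} R) n).map) (hg j)
    rw [Functor.map_comp, Functor.map_comp] at this
    exact (ConcreteCategory.congr_hom this z).symm
  exact hy

end DerivedCoproducts

section Products

open Limits HomologicalComplex

variable {R : Type u} [Ring R] {J : Type u}

lemma HomologicalComplex.exists_d_eq_iCycles_of_homologyπ_eq_zero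
    (K : CochainComplex (ModuleCat.{u} R) ℤ) (n : ℤ) (z : K.cycles n)
    (hz : K.homologyπ n z = 0) : ∃ w : K.X (n - 1), K.d (n - 1) n w = K.iCycles n z := by
  have hex := ShortComplex.exact_of_g_is_cokernel (.mk _ _ (K.toCycles_comp_homologyπ (n - 1) n))
    (K.homologyIsCokernel (n - 1) n (by simp))
  obtain ⟨w, hw⟩ := (ShortComplex.moduleCat_exact_iff _).1 hex z hz
  refine ⟨w, ?_⟩
  rw [← K.toCycles_i (n - 1) n, ConcreteCategory.comp_apply]
  exact congrArg _ hw

lemma HomologicalComplex.exists_iCycles_eq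
    (K : CochainComplex (ModuleCat.{u} R) ℤ) (n : ℤ) (x : K.X n)
    (hx : K.d n (n + 1) x = 0) : ∃ z : K.cycles n, K.iCycles n z = x := by
  have hex := ShortComplex.exact_of_f_is_kernel (.mk _ _ (K.iCycles_d n (n + 1)))
    (K.cyclesIsKernel n (n + 1) (by simp))
  exact (ShortComplex.moduleCat_exact_iff _).1 hex x hx

lemma ModuleCat.exists_proj_eq_of_isLimit {M : J → ModuleCat.{u} R} {N : ModuleCat.{u} R}
    {p : ∀ j, N ⟶ M j} (h : IsLimit (Fan.mk N p)) (x : ∀ j, M j) : ∃ y : N, ∀ j, p j y = x j := by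
  let f : ∀ j, ModuleCat.of R R ⟶ M j := fun j =>
    ModuleCat.ofHom (LinearMap.toSpanSingleton R (M j) (x j))
  refine ⟨Fan.IsLimit.lift h f (1 : R), fun j => ?_⟩
  refine (ConcreteCategory.congr_hom (Fan.IsLimit.fac h f j) (1 : R)).trans ?_
  exact one_smul R (x j)

lemma ModuleCat.eq_zero_of_isLimit {M : J → ModuleCat.{u} R} {N : ModuleCat.{u} R}
    {p : ∀ j, N ⟶ M j} (h : IsLimit (Fan.mk N p)) (y : N) (hy : ∀ j, p j y = 0) : y = 0 := by
  have : ModuleCat.ofHom (LinearMap.toSpanSingleton R N y) = 0 := by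
    refine Fan.IsLimit.hom_ext h _ _ fun j => ?_
    ext
    change p j ((1 : R) • y) = p j 0
    rw [one_smul, hy, map_zero]
  rw [← one_smul R y]
  exact ConcreteCategory.congr_hom this (1 : R)

section Complexes

variable {K : J → CochainComplex (ModuleCat.{u} R) ℤ} {L : CochainComplex (ModuleCat.{u} R) ℤ}
  {p : ∀ j, L ⟶ K j} (h : IsLimit (Fan.mk L p))

/-- Degreewise, a product of complexes is a product. -/
noncomputable def isLimitFanMkX (n : ℤ) :
    IsLimit (Fan.mk (L.X n) fun j => (p j).f n) :=
  isLimitFanMkObjOfIsLimit (eval _ _ n) _ _ h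

lemma HomologicalComplex.Hom.comm_apply {K L : CochainComplex (ModuleCat.{u} R) ℤ} (f : K ⟶ L)
    (n m : ℤ) (x : K.X n) : L.d n m (f.f n x) = f.f m (K.d n m x) :=
  ConcreteCategory.congr_hom (f.comm n m) x

lemma HomologicalComplex.homologyMap_homologyπ_apply {K L : CochainComplex (ModuleCat.{u} R) ℤ}
    (f : K ⟶ L) (n : ℤ) (z : K.cycles n) :
    homologyMap f n (K.homologyπ n z) = L.homologyπ n (cyclesMap f n z) :=
  ConcreteCategory.congr_hom (homologyπ_naturality f n) z

lemma HomologicalComplex.iCycles_cyclesMap_apply {K L : CochainComplex (ModuleCat.{u} R) ℤ}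
    (f : K ⟶ L) (n : ℤ) (z : K.cycles n) :
    L.iCycles n (cyclesMap f n z) = f.f n (K.iCycles n z) :=
  ConcreteCategory.congr_hom (cyclesMap_i f n) z

lemma HomologicalComplex.homologyπ_surjective (K : CochainComplex (ModuleCat.{u} R) ℤ) (n : ℤ) :
    Function.Surjective (K.homologyπ n) :=
  (ModuleCat.epi_iff_surjective _).1 inferInstance

lemma HomologicalComplex.iCycles_injective (K : CochainComplex (ModuleCat.{u} R) ℤ) (n : ℤ) :
    Function.Injective (K.iCycles n) :=
  (ModuleCat.mono_iff_injective _).1 inferInstance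

include h in
lemma homology_eq_zero_of_isLimit (n : ℤ) (x : L.homology n)
    (hx : ∀ j, homologyMap (p j) n x = 0) : x = 0 := by
  obtain ⟨z, rfl⟩ := L.homologyπ_surjective n x
  simp only [homologyMap_homologyπ_apply] at hx
  choose w hw using fun j => (K j).exists_d_eq_iCycles_of_homologyπ_eq_zero n _ (hx j)
  obtain ⟨v, hv⟩ := ModuleCat.exists_proj_eq_of_isLimit (isLimitFanMkX h (n - 1)) w
  have hz : L.toCycles (n - 1) n v = z := by
    apply L.iCycles_injective
    rw [← ConcreteCategory.comp_apply, L.toCycles_i, ← sub_eq_zero]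
    refine ModuleCat.eq_zero_of_isLimit (isLimitFanMkX h n) _ fun j => ?_
    rw [map_sub, ← Hom.comm_apply, hv, hw, iCycles_cyclesMap_apply, sub_self]
  rw [← hz, ← ConcreteCategory.comp_apply, toCycles_comp_homologyπ]
  rfl

include h in
lemma exists_homology_of_isLimit (n : ℤ) (x : ∀ j, (K j).homology n) :
    ∃ y : L.homology n, ∀ j, homologyMap (p j) n y = x j := by
  choose z hz using fun j => (K j).homologyπ_surjective n (x j)
  obtain ⟨v, hv⟩ := ModuleCat.exists_proj_eq_of_isLimit (isLimitFanMkX h n)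
    fun j => (K j).iCycles n (z j)
  have hd : L.d n (n + 1) v = 0 := by
    refine ModuleCat.eq_zero_of_isLimit (isLimitFanMkX h (n + 1)) _ fun j => ?_
    rw [← Hom.comm_apply, hv, ← ConcreteCategory.comp_apply, iCycles_d]
    rfl
  obtain ⟨y, hy⟩ := L.exists_iCycles_eq n v hd
  refine ⟨L.homologyπ n y, fun j => ?_⟩
  rw [homologyMap_homologyπ_apply, ← hz]
  congr 1
  apply (K j).iCycles_injective
  rw [iCycles_cyclesMap_apply, hy, hv]

variable {K' : J → CochainComplex (ModuleCat.{u} R) ℤ} {L' : CochainComplex (ModuleCat.{u} R) ℤ}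
  {p' : ∀ j, L' ⟶ K' j}

include h in
lemma quasiIso_of_isLimit (h' : IsLimit (Fan.mk L' p')) (s : ∀ j, K j ⟶ K' j)
    [∀ j, QuasiIso (s j)] (f : L ⟶ L') (hf : ∀ j, f ≫ p' j = p j ≫ s j) : QuasiIso f := by
  have hfH : ∀ n j y, homologyMap (p' j) n (homologyMap f n y) =
      homologyMap (s j) n (homologyMap (p j) n y) := fun n j y => by
    simpa only [homologyMap_comp, ConcreteCategory.comp_apply] using
      ConcreteCategory.congr_hom (congrArg (homologyMap · n) (hf j)) y
  have hs : ∀ n j, Function.Bijective (homologyMap (s j) n) := fun n j =>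
    ConcreteCategory.bijective_of_isIso _
  rw [quasiIso_iff]
  intro n
  rw [quasiIsoAt_iff_isIso_homologyMap, ConcreteCategory.isIso_iff_bijective]
  constructor
  · rw [injective_iff_map_eq_zero]
    refine fun x hx => homology_eq_zero_of_isLimit h n x fun j => (hs n j).1 ?_
    rw [← hfH, hx, map_zero, map_zero]
  · intro y
    choose g hg using fun j => (hs n j).2 (homologyMap (p' j) n y)
    obtain ⟨x, hx⟩ := exists_homology_of_isLimit h n g
    refine ⟨x, sub_eq_zero.1 (homology_eq_zero_of_isLimit h' n _ fun j => ?_)⟩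
    rw [map_sub, hfH, hx, hg, sub_self]

open DerivedCategory in
include h in
lemma exists_lift_Q {X : DerivedCategory (ModuleCat.{u} R)} (f : ∀ j, X ⟶ Q.obj (K j)) :
    ∃ g : X ⟶ Q.obj L, ∀ j, g ≫ Q.map (p j) = f j := by
  let e := Q.objObjPreimageIso X
  choose K' g s hs hg using fun j => left_fac (e.hom ≫ f j)
  have : ∀ j, QuasiIso (s j) := fun j => by rw [← isIso_Q_map_iff_quasiIso]; exact hs j
  let c := productIsProduct K'
  let t : L ⟶ ∏ᶜ K' := Fan.IsLimit.lift c fun j => p j ≫ s j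
  have ht : ∀ j, t ≫ Pi.π K' j = p j ≫ s j := Fan.IsLimit.fac c _
  have : QuasiIso t := quasiIso_of_isLimit h c s t ht
  refine ⟨e.inv ≫ Q.map (Pi.lift g) ≫ inv (Q.map t), fun j => ?_⟩
  have h1 : inv (Q.map t) ≫ Q.map (p j) = Q.map (Pi.π K' j) ≫ inv (Q.map (s j)) := by
    rw [IsIso.inv_comp_eq, ← Category.assoc, IsIso.eq_comp_inv, ← Q.map_comp, ← Q.map_comp, ht]
  have h2 : Q.map (Pi.lift g) ≫ Q.map (Pi.π K' j) = Q.map (g j) := by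
    rw [← Q.map_comp, Pi.lift_π]
  rw [Category.assoc, Category.assoc, h1, reassoc_of% h2, ← hg, e.inv_hom_id_assoc]

variable {L₀ : CochainComplex (ModuleCat.{u} R) ℤ} {i : ∀ j, K j ⟶ L₀}
  (h₀ : IsColimit (Cofan.mk L₀ i))

include h h₀ in
/-- A coproduct of complexes is isomorphic to their product if in each degree
at most one of the complexes is nonzero. -/
lemma isIso_of_isColimit_of_isLimit
    (hK : ∀ m, ∃ j₀, ∀ j ≠ j₀, Subsingleton ((K j).X m)) (f : L₀ ⟶ L)
    (hf : ∀ j, f ≫ p j = cofanProj h₀ j) : IsIso f := by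
  have hfX : ∀ m j x, (p j).f m (f.f m x) = (cofanProj h₀ j).f m x := fun m j x =>
    ConcreteCategory.congr_hom (congrArg (fun φ => φ.f m) (hf j)) x
  have hself : ∀ m j y, (cofanProj h₀ j).f m ((i j).f m y) = y := fun m j y =>
    ConcreteCategory.congr_hom (congrArg (fun φ => φ.f m) (cofanProj_self h₀ j)) y
  have (m : ℤ) : IsIso (f.f m) := by
    rw [ConcreteCategory.isIso_iff_bijective]
    constructor
    · rw [injective_iff_map_eq_zero]
      intro x hx
      obtain ⟨s, hs⟩ := exists_sum_proj_X h₀ m x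
      rw [hs]
      refine Finset.sum_eq_zero fun j _ => ?_
      rw [← hfX, hx, map_zero, map_zero]
    · intro y
      obtain ⟨j₀, hj₀⟩ := hK m
      refine ⟨(i j₀).f m ((p j₀).f m y), sub_eq_zero.1
        (ModuleCat.eq_zero_of_isLimit (isLimitFanMkX h m) _ fun j => ?_)⟩
      by_cases hj : j = j₀
      · subst hj
        rw [map_sub, hfX, hself, sub_self]
      · have := hj₀ j hj
        exact Subsingleton.elim _ _
  exact HomologicalComplex.Hom.isIso_of_components f

end Complexes

end Products

section Boundedness

open Limits HomologicalComplex DerivedCategory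

lemma exists_homologyMap_mkHomFromSingle_eq {R : Type u} [Ring R]
    (K : CochainComplex (ModuleCat.{u} R) ℤ) (n : ℤ) (y : K.homology n) :
    ∃ f : (single (ModuleCat.{u} R) (.up ℤ) n).obj (ModuleCat.of R R) ⟶ K,
      homologyMap f n
        ((singleObjHomologySelfIso (.up ℤ) n (ModuleCat.of R R)).inv (1 : R)) = y := by
  obtain ⟨z, rfl⟩ := K.homologyπ_surjective n y
  let φ : ModuleCat.of R R ⟶ K.cycles n := ModuleCat.ofHom (LinearMap.toSpanSingleton R _ z)
  let f : (single (ModuleCat.{u} R) (.up ℤ) n).obj (ModuleCat.of R R) ⟶ K :=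
    mkHomFromSingle (φ ≫ K.iCycles n) fun k _ => by simp
  have hf : (singleObjCyclesSelfIso (.up ℤ) n (ModuleCat.of R R)).inv ≫ cyclesMap f n = φ := by
    rw [← cancel_mono (K.iCycles n), Category.assoc, cyclesMap_i,
      singleObjCyclesSelfIso_inv_iCycles_assoc, mkHomFromSingle_f, Iso.inv_hom_id_assoc]
  refine ⟨f, ?_⟩
  have h : (singleObjHomologySelfIso (.up ℤ) n (ModuleCat.of R R)).inv ≫ homologyMap f n =
      φ ≫ K.homologyπ n := by
    rw [← singleObjCyclesSelfIso_inv_homologyπ, Category.assoc, homologyπ_naturality, ← hf,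
      Category.assoc]
  refine (ConcreteCategory.congr_hom h (1 : R)).trans ?_
  exact congrArg (K.homologyπ n) (one_smul R z)

/-- The free module of rank one, in degree zero, represents `H⁰` in the derived category. -/
lemma DerivedCategory.exists_generator_homologyFunctor_zero (R : Type u) [Ring R] :
    ∃ (P : DerivedCategory (ModuleCat.{u} R)) (b : (homologyFunctor (ModuleCat.{u} R) 0).obj P),
      ∀ (Y : DerivedCategory (ModuleCat.{u} R)) (y : (homologyFunctor (ModuleCat.{u} R) 0).obj Y),
        ∃ f : P ⟶ Y, (homologyFunctor (ModuleCat.{u} R) 0).map f b = y := by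
  let H := homologyFunctor (ModuleCat.{u} R) 0
  let e (K : CochainComplex (ModuleCat.{u} R) ℤ) : H.obj (Q.obj K) ≅ K.homology 0 :=
    (homologyFunctorFactors (ModuleCat.{u} R) 0).app K
  have he {K L : CochainComplex (ModuleCat.{u} R) ℤ} (f : K ⟶ L) :
      (e K).inv ≫ H.map (Q.map f) = homologyMap f 0 ≫ (e L).inv :=
    ((homologyFunctorFactors (ModuleCat.{u} R) 0).inv.naturality f).symm
  let P₀ := (single (ModuleCat.{u} R) (.up ℤ) 0).obj (ModuleCat.of R R)
  let b₀ : P₀.homology 0 := (singleObjHomologySelfIso (.up ℤ) 0 (ModuleCat.of R R)).inv (1 : R)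
  refine ⟨Q.obj P₀, (e P₀).inv b₀, fun Y y => ?_⟩
  let eY := Q.objObjPreimageIso Y
  obtain ⟨f, hf⟩ := exists_homologyMap_mkHomFromSingle_eq (Q.objPreimage Y) 0
    ((e _).hom (H.map eY.inv y))
  refine ⟨Q.map f ≫ eY.hom, ?_⟩
  have h1 : (e P₀).inv ≫ H.map (Q.map f ≫ eY.hom) =
      homologyMap f 0 ≫ (e _).inv ≫ H.map eY.hom := by
    rw [H.map_comp, reassoc_of% he f]
  have h2 : H.map eY.inv ≫ (e _).hom ≫ (e _).inv ≫ H.map eY.hom = 𝟙 _ := by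
    rw [Iso.hom_inv_id_assoc, ← H.map_comp, eY.inv_hom_id, H.map_id]
  refine (ConcreteCategory.congr_hom h1 b₀).trans ?_
  exact (congrArg ((e _).inv ≫ H.map eY.hom) hf).trans (ConcreteCategory.congr_hom h2 y)

variable {A B : Type u} [Ring A] [Ring B]
  (F : DerivedCategory (ModuleCat.{u} A) ≌ DerivedCategory (ModuleCat.{u} B))

lemma exists_finset_homologyFunctor_map_cofanProj_eq_zero {J : Type u}
    {K : J → CochainComplex (ModuleCat.{u} A) ℤ} {L : CochainComplex (ModuleCat.{u} A) ℤ}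
    {i : ∀ j, K j ⟶ L} (h : IsColimit (Cofan.mk L i)) (n : ℤ)
    (x : (homologyFunctor (ModuleCat.{u} B) n).obj (F.functor.obj (Q.obj L))) :
    ∃ s : Finset J, ∀ j ∉ s, (homologyFunctor (ModuleCat.{u} B) n).map
      (F.functor.map (Q.map (cofanProj h j))) x = 0 := by
  classical
  have hc := isColimitCofanMkObjOfIsColimit F.functor _ _ (isColimitCofanMkQ h)
  have hx := (eq_top_iff.1 (iSup_range_homologyFunctor_of_isColimit hc n))
    (Submodule.mem_top (x := x))
  induction hx using Submodule.iSup_induction' with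
  | mem j x hx =>
    obtain ⟨y, rfl⟩ := hx
    refine ⟨{j}, fun j' hj' => ?_⟩
    have : (homologyFunctor (ModuleCat.{u} B) n).map (F.functor.map (Q.map (i j))) ≫
        (homologyFunctor (ModuleCat.{u} B) n).map
          (F.functor.map (Q.map (cofanProj h j'))) = 0 := by
      rw [← Functor.map_comp, ← Functor.map_comp, ← Functor.map_comp,
        cofanProj_ne h (fun e => hj' (Finset.mem_singleton.2 e.symm))]
      simp
    exact ConcreteCategory.congr_hom this y
  | zero => exact ⟨∅, fun _ _ => map_zero _⟩
  | add x y _ _ hx hy =>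
    obtain ⟨s, hs⟩ := hx
    obtain ⟨t, ht⟩ := hy
    refine ⟨s ∪ t, fun j hj => ?_⟩
    rw [Finset.notMem_union] at hj
    rw [map_add, hs j hj.1, ht j hj.2, add_zero]

/-- A family of complexes such that at most one of them is nonzero in each degree
has almost all images under an equivalence acyclic in degree zero. -/
lemma finite_setOf_nontrivial_homology {J : Type u} (K : J → CochainComplex (ModuleCat.{u} A) ℤ)
    (hK : ∀ m, ∃ j₀, ∀ j ≠ j₀, Subsingleton ((K j).X m)) :
    {j | Nontrivial ((homologyFunctor (ModuleCat.{u} B) 0).obj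
      (F.functor.obj (Q.obj (K j))))}.Finite := by
  classical
  let H := homologyFunctor (ModuleCat.{u} B) 0
  obtain ⟨P, b, hb⟩ := exists_generator_homologyFunctor_zero B
  have hy : ∀ j, ∃ y : H.obj (F.functor.obj (Q.obj (K j))),
      Nontrivial (H.obj (F.functor.obj (Q.obj (K j)))) → y ≠ 0 := fun j => by
    by_cases hj : Nontrivial (H.obj (F.functor.obj (Q.obj (K j))))
    · obtain ⟨y, hy⟩ := exists_ne (0 : H.obj (F.functor.obj (Q.obj (K j))))
      exact ⟨y, fun _ => hy⟩
    · exact ⟨0, fun h => (hj h).elim⟩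
  choose y hy using hy
  choose f hf using fun j => hb _ (y j)
  let ε := F.counitIso.app P
  let g : ∀ j, F.inverse.obj P ⟶ Q.obj (K j) := fun j => F.functor.preimage (ε.hom ≫ f j)
  let c := coproductIsCoproduct K
  let p := productIsProduct K
  obtain ⟨g', hg'⟩ := exists_lift_Q p g
  let t : (∐ K) ⟶ (∏ᶜ K) := Fan.IsLimit.lift p (cofanProj c)
  have ht : ∀ j, t ≫ Pi.π K j = cofanProj c j := Fan.IsLimit.fac p _
  have : IsIso t := isIso_of_isColimit_of_isLimit p c hK t ht
  have hproj : ∀ j, (ε.inv ≫ F.functor.map (g' ≫ inv (Q.map t))) ≫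
      F.functor.map (Q.map (cofanProj c j)) = f j := fun j => by
    have h1 : inv (Q.map t) ≫ Q.map (cofanProj c j) = Q.map (Pi.π K j) := by
      rw [IsIso.inv_comp_eq, ← Q.map_comp, ht]
    have h2 : g' ≫ Q.map (Pi.π K j) = g j := hg' j
    rw [Category.assoc, ← F.functor.map_comp, Category.assoc, h1, h2, F.functor.map_preimage,
      Iso.inv_hom_id_assoc]
  obtain ⟨s, hs⟩ := exists_finset_homologyFunctor_map_cofanProj_eq_zero F c 0
    (H.map (ε.inv ≫ F.functor.map (g' ≫ inv (Q.map t))) b)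
  refine s.finite_toSet.subset fun j hj => ?_
  by_contra hjs
  refine hy j hj ?_
  rw [← hf, ← hproj, Functor.map_comp, ConcreteCategory.comp_apply]
  exact hs j hjs

/-- The homology of the image of `M` placed in degree `n` is that of the image of `M`,
up to a shift. -/
noncomputable def homologyFunctorMapSingleIso {F : DerivedCategory (ModuleCat.{u} A) ⥤
    DerivedCategory (ModuleCat.{u} B)} [F.CommShift ℤ] (M : ModuleCat.{u} A) (n m m' : ℤ)
    (h : m' + n = m) :
    (homologyFunctor (ModuleCat.{u} B) m).obj
        (F.obj ((singleFunctor (ModuleCat.{u} A) n).obj M)) ≅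
      (homologyFunctor (ModuleCat.{u} B) m').obj
        (F.obj ((singleFunctor (ModuleCat.{u} A) 0).obj M)) :=
  (homologyFunctor (ModuleCat.{u} B) m).mapIso
      (F.mapIso (((singleFunctors (ModuleCat.{u} A)).shiftIso (-n) n 0 (by lia)).symm.app M) ≪≫
        (F.commShiftIso (-n)).app _) ≪≫
    ((homologyFunctor (ModuleCat.{u} B) 0).shiftIso (-n) m m' (by lia)).app _

lemma exists_bound_homologyFunctor_obj_single (hF : IsTriangulatedEquiv F)
    (T : ModuleCat.{u} A) : ∃ N : ℕ, ∀ m : ℤ, N < |m| →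
      IsZero ((homologyFunctor (ModuleCat.{u} B) m).obj
        (F.functor.obj ((singleFunctor (ModuleCat.{u} A) 0).obj T))) := by
  obtain ⟨_, _⟩ := hF
  let K : ULift.{u} ℤ → CochainComplex (ModuleCat.{u} A) ℤ := fun n =>
    (single (ModuleCat.{u} A) (.up ℤ) n.down).obj T
  have hK := finite_setOf_nontrivial_homology F K fun m => ⟨⟨m⟩, fun j hj =>
    ModuleCat.subsingleton_of_isZero (isZero_single_obj_X _ _ _ _
      fun e => hj (ULift.down_injective e.symm))⟩
  obtain ⟨N, hN⟩ := (hK.image fun j => j.down.natAbs).bddAbove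
  refine ⟨N, fun m hm => ?_⟩
  by_contra hz
  have : (-m).natAbs ≤ N := by
    refine hN ⟨⟨-m⟩, ?_, rfl⟩
    let e := homologyFunctorMapSingleIso (F := F.functor) T (-m) 0 m (by lia)
    refine not_subsingleton_iff_nontrivial.1 fun hs => hz ?_
    exact (@ModuleCat.isZero_of_subsingleton _ _ _ hs).of_iso e.symm
  rw [Int.abs_eq_natAbs] at hm
  lia

end Boundedness

section Devissage

open Limits DerivedCategory Pretriangulated DirectSum

variable {B C : Type u} [Ring B] [Ring C]
  (G : DerivedCategory (ModuleCat.{u} B) ≌ DerivedCategory (ModuleCat.{u} C))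
  {E : Set (ModuleCat.{u} C)} {m : ℤ}

lemma FactorsIn.of_distTriang [G.functor.CommShift ℤ] [G.functor.IsTriangulated]
    (T : Triangle (DerivedCategory (ModuleCat.{u} B))) (hT : T ∈ distTriang _)
    (h₁ : FactorsIn E ((homologyFunctor _ m).obj (G.functor.obj T.obj₁)))
    (h₃ : FactorsIn E ((homologyFunctor _ m).obj (G.functor.obj T.obj₃))) :
    FactorsIn E ((homologyFunctor _ m).obj (G.functor.obj T.obj₂)) :=
  FactorsIn.of_exact (HomologySequence.exact₂ _ (G.functor.map_distinguished T hT) m) h₁ h₃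

lemma FactorsIn.of_isColimit_single {J : Type u} {Z : J → ModuleCat.{u} B} {M : ModuleCat.{u} B}
    {i : ∀ j, Z j ⟶ M} (h : IsColimit (Cofan.mk M i))
    (hZ : ∀ j, FactorsIn E ((homologyFunctor _ m).obj
      (G.functor.obj ((singleFunctor _ 0).obj (Z j))))) :
    FactorsIn E ((homologyFunctor _ m).obj (G.functor.obj ((singleFunctor _ 0).obj M))) := by
  have h' := isColimitCofanMkObjOfIsColimit G.functor _ _
    (isColimitCofanMkQ
      (isColimitCofanMkObjOfIsColimit (HomologicalComplex.single _ (.up ℤ) 0) _ _ h))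
  exact FactorsIn.of_iSup_range_eq_top hZ _ (iSup_range_homologyFunctor_of_isColimit h' m)

lemma isCompositionFactor_submodule (M : ModuleCat.{u} B) (N : Submodule B M)
    [IsSimpleModule B N] : IsCompositionFactor B (ModuleCat.of B N) M := by
  refine (isCompositionFactor_iff _ _).2 ⟨‹_›, fun h => ?_⟩
  have := IsSimpleModule.nontrivial B N
  obtain ⟨y, hy⟩ := exists_ne (0 : N)
  exact hy (LinearMap.congr_fun (h N LinearMap.id) y)

/-- The factors of the cohomology of the image of a module are controlled by its composition
factors. -/
lemma FactorsIn.homologyFunctor_obj_single [IsSemiprimaryRing B] (hG : IsTriangulatedEquiv G)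
    {S : Set (ModuleCat.{u} B)}
    (hS : ∀ V ∈ S, FactorsIn E ((homologyFunctor _ m).obj
      (G.functor.obj ((singleFunctor _ 0).obj V))))
    {M : ModuleCat.{u} B} (hM : FactorsIn S M) :
    FactorsIn E ((homologyFunctor _ m).obj (G.functor.obj ((singleFunctor _ 0).obj M))) := by
  obtain ⟨_, _⟩ := hG
  refine IsSemiprimaryRing.induction ℤ B M (P := fun M _ _ _ => FactorsIn S (.of B M) →
    FactorsIn E ((homologyFunctor _ m).obj
      (G.functor.obj ((singleFunctor _ 0).obj (.of B M))))) ?_ ?_ hM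
  · intro M _ _ _ _ _ _ hM
    obtain ⟨s, e, -, hs⟩ := IsSemisimpleModule.exists_linearEquiv_dfinsupp B M
    classical
    have key := FactorsIn.of_isColimit_single (E := E) (m := m) G
      (ModuleCat.coproductCoconeIsColimit fun j : s => ModuleCat.of B j.1) fun j => by
        have := hs j
        obtain ⟨V, hV, ⟨a⟩⟩ := hM _ (isCompositionFactor_submodule (.of B M) j.1)
        exact (hS V hV).of_iso ((homologyFunctor _ m).mapIso
          (G.functor.mapIso ((singleFunctor _ 0).mapIso a.symm)))
    exact key.of_iso ((homologyFunctor _ m).mapIso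
      (G.functor.mapIso ((singleFunctor _ 0).mapIso e.symm.toModuleIso)))
  · intro M _ _ _ _ N hN hQ hM
    let T : ShortComplex (ModuleCat.{u} B) := ShortComplex.mk (ModuleCat.ofHom N.subtype)
      (ModuleCat.ofHom N.mkQ) (by ext x; simp)
    have hT : T.ShortExact := by
      refine ShortComplex.ShortExact.mk' ?_ ?_ ?_
      · rw [ShortComplex.moduleCat_exact_iff_range_eq_ker]
        simp [T]
      · exact (ModuleCat.mono_iff_injective _).2 N.injective_subtype
      · exact (ModuleCat.epi_iff_surjective _).2 N.mkQ_surjective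
    exact FactorsIn.of_distTriang G _ hT.singleTriangle_distinguished
      (hN (hM.of_injective (M := .of B N) N.subtype N.injective_subtype))
      (hQ (hM.of_surjective (N := .of B (M ⧸ N)) N.mkQ N.mkQ_surjective))

/-- The factors of the cohomology of the image of a bounded object are controlled by the
composition factors of its cohomology. -/
lemma FactorsIn.homologyFunctor_obj_of_isGE_of_isLE [IsSemiprimaryRing B]
    (hG : IsTriangulatedEquiv G) {S : ℤ → Set (ModuleCat.{u} B)}
    (hS : ∀ n, ∀ V ∈ S n, FactorsIn E ((homologyFunctor _ (m - n)).obj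
      (G.functor.obj ((singleFunctor _ 0).obj V)))) (a : ℤ) (N : ℕ)
    (X : DerivedCategory (ModuleCat.{u} B)) (hge : X.IsGE a) (hle : X.IsLE (a + N))
    (hX : ∀ n, FactorsIn (S n) ((homologyFunctor _ n).obj X)) :
    FactorsIn E ((homologyFunctor _ m).obj (G.functor.obj X)) := by
  have hsingle : ∀ (b : ℤ) (X : DerivedCategory (ModuleCat.{u} B)), X.IsGE b → X.IsLE b →
      (∀ n, FactorsIn (S n) ((homologyFunctor _ n).obj X)) →
      FactorsIn E ((homologyFunctor _ m).obj (G.functor.obj X)) := by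
    intro b X _ _ hX
    obtain ⟨Y, ⟨e⟩⟩ := exists_iso_singleFunctor_obj_of_isGE_of_isLE X b
    let e' : (homologyFunctor _ b).obj ((singleFunctor _ b).obj Y) ≅ Y :=
      (homologyFunctorFactors _ b).app _ ≪≫
        HomologicalComplex.singleObjHomologySelfIso (.up ℤ) b Y
    have hY : FactorsIn (S b) Y := (hX b).of_iso ((homologyFunctor _ b).mapIso e ≪≫ e')
    have h := FactorsIn.homologyFunctor_obj_single G hG (hS b) hY
    obtain ⟨_, _⟩ := hG
    exact (h.of_iso (homologyFunctorMapSingleIso Y b m (m - b) (by lia)).symm).of_iso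
      ((homologyFunctor _ m).mapIso (G.functor.mapIso e.symm))
  induction N generalizing X with
  | zero => exact hsingle a X hge (by simpa using hle) hX
  | succ N ih =>
    obtain ⟨Y, Z, hY, hZ, f, g, δ, hT⟩ := TStructure.t.exists_triangle X (a + N) (a + (N + 1 : ℕ))
      (by push_cast; lia)
    have hY' : Y.IsLE (a + N) := ⟨hY⟩
    have hZ' : Z.IsGE (a + (N + 1 : ℕ)) := ⟨hZ⟩
    have ex₁ := fun n => HomologySequence.exact₁ _ hT (n - 1) n (by lia)
    have ex₃ := fun n => HomologySequence.exact₃ _ hT n (n + 1) rfl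
    have hYX : ∀ n, n ≤ a + N → FactorsIn (S n) ((homologyFunctor _ n).obj Y) := fun n hn =>
      FactorsIn.of_exact (ex₁ n)
        (.of_isZero (Z.isZero_of_isGE (a + (N + 1 : ℕ)) (n - 1) (by push_cast; lia))) (hX n)
    have hZX : ∀ n, a + N < n → FactorsIn (S n) ((homologyFunctor _ n).obj Z) := fun n hn =>
      FactorsIn.of_exact (ex₃ n) (hX n) (.of_isZero (Y.isZero_of_isLE (a + N) (n + 1) (by lia)))
    have hYge : Y.IsGE a := (isGE_iff _ _).2 fun n hn => (ex₁ n).isZero_of_both_isZero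
      (Z.isZero_of_isGE (a + (N + 1 : ℕ)) (n - 1) (by push_cast; lia)) (X.isZero_of_isGE a n hn)
    have hZle : Z.IsLE (a + (N + 1 : ℕ)) := (isLE_iff _ _).2 fun n hn =>
      (ex₃ n).isZero_of_both_isZero (X.isZero_of_isLE (a + (N + 1 : ℕ)) n hn)
        (Y.isZero_of_isLE (a + N) (n + 1) (by push_cast at hn; lia))
    have h₁ := ih Y hYge hY' fun n => by
      rcases le_or_gt n (a + N) with hn | hn
      · exact hYX n hn
      · exact .of_isZero (Y.isZero_of_isLE (a + N) n hn)
    have h₃ := hsingle _ Z hZ' hZle fun n => by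
      rcases le_or_gt n (a + N) with hn | hn
      · exact .of_isZero (Z.isZero_of_isGE (a + (N + 1 : ℕ)) n (by push_cast; lia))
      · exact hZX n hn
    obtain ⟨_, _⟩ := hG
    exact FactorsIn.of_distTriang G _ hT h₁ h₃

end Devissage

lemma IsSimplesFiltration.exists_mem_notMem {R : Type u} [Ring R] {r : ℕ}
    {S : ℤ → Set (ModuleCat.{u} R)} (hS : IsSimplesFiltration R r S) (i : ℤ)
    {V : ModuleCat.{u} R} (hV : V ∈ S i) : ∃ l, 0 ≤ l ∧ l ≤ i ∧ V ∈ S l ∧ V ∉ S (l - 1) := by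
  have hneg : ∀ l < 0, V ∉ S l := fun l hl h => by simp [hS.2.1 l hl] at h
  have hi : 0 ≤ i := not_lt.1 fun hi => hneg i hi hV
  lift i to ℕ using hi
  induction i with
  | zero => exact ⟨0, le_rfl, le_rfl, hV, hneg _ (by lia)⟩
  | succ i ih =>
    by_cases h : V ∈ S i
    · obtain ⟨l, h0, hl, h⟩ := ih h
      exact ⟨l, h0, by push_cast; lia, h⟩
    · exact ⟨_, by positivity, le_rfl, hV, by simpa using h⟩

lemma IsPerverse.factorsIn {A B : Type u} [Ring A] [Ring B]
    {F : DerivedCategory (ModuleCat.{u} A) ⥤ DerivedCategory (ModuleCat.{u} B)}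
    {r : ℕ} {q : ℤ → ℤ} {S : ℤ → Set (ModuleCat.{u} A)} {S' : ℤ → Set (ModuleCat.{u} B)}
    (hF : IsPerverse F r q S S') {i : ℤ} (hi : i ≤ r) {V : ModuleCat.{u} A} (hV : V ∈ S i)
    (m : ℤ) : FactorsIn (S' (if m = -q i then i else i - 1))
      ((DerivedCategory.homologyFunctor _ m).obj
        (F.obj ((DerivedCategory.singleFunctor _ 0).obj V))) := by
  obtain ⟨l, h0, hl, hVl, hVl'⟩ := hF.1.exists_mem_notMem i hV
  have h := hF.2.2 l h0 (hl.trans hi) V hVl hVl' (-m)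
  rw [neg_neg] at h
  refine FactorsIn.mono h (hF.2.1.1 _ _ ?_)
  rcases eq_or_ne l i with rfl | hne
  · split_ifs <;> lia
  · split_ifs <;> lia

/-- The composition of a perverse equivalence `𝓕 : D^b(A) → D^b(B)` with respect to
`(r, q, 𝒮, 𝒮')` and a perverse equivalence `𝓖 : D^b(B) → D^b(C)` with respect to
`(r, q', 𝒮', 𝒮'')` is a perverse equivalence with respect to `(r, q + q', 𝒮, 𝒮'')`. -/
theorem composition_of_perverse_equivalences_is_perverse
    {k : Type u} [Field k] [IsAlgClosed k]
    {A B C : Type u} [Ring A] [Algebra k A] [FiniteDimensional k A]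
    [Ring B] [Algebra k B] [FiniteDimensional k B]
    [Ring C] [Algebra k C] [FiniteDimensional k C]
    (F : DerivedCategory (ModuleCat.{u} A) ≌ DerivedCategory (ModuleCat.{u} B))
    (hFtri : IsTriangulatedEquiv F)
    (G : DerivedCategory (ModuleCat.{u} B) ≌ DerivedCategory (ModuleCat.{u} C))
    (hGtri : IsTriangulatedEquiv G)
    (r : ℕ) (q q' : ℤ → ℤ) (S : ℤ → Set (ModuleCat.{u} A)) (S' : ℤ → Set (ModuleCat.{u} B))
    (S'' : ℤ → Set (ModuleCat.{u} C))
    (hF : IsPerverse F.functor r q S S')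
    (hG : IsPerverse G.functor r q' S' S'') :
    IsPerverse (F.functor ⋙ G.functor) r (fun i => q i + q' i) S S'' := by
  have : IsArtinianRing B := IsArtinianRing.of_finite k B
  refine ⟨hF.1, hG.2.1, fun i _ hir T hT _ j => ?_⟩
  obtain ⟨N, hN⟩ := exists_bound_homologyFunctor_obj_single F hFtri T
  refine FactorsIn.homologyFunctor_obj_of_isGE_of_isLE G hGtri
    (S := fun n => S' (if n = -q i then i else i - 1)) (fun n V hV => ?_) (-N) (2 * N) _
    ((DerivedCategory.isGE_iff _ _).2 fun n hn => hN n (lt_abs.2 (.inr (by lia))))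
    ((DerivedCategory.isLE_iff _ _).2 fun n hn => hN n (lt_abs.2 (.inl (by push_cast at hn; lia))))
    (hF.factorsIn hir hT)
  split_ifs at hV with hn
  · refine (hG.factorsIn hir hV (-j - n)).mono (hG.2.1.1 _ _ ?_)
    split_ifs <;> lia
  · refine (hG.factorsIn (by lia) hV (-j - n)).mono (hG.2.1.1 _ _ ?_)
    split_ifs <;> lia
end

section
/- Let k be an algebraically closed field, σ: k → k a field automorphism, and A a finite-dimensional k-algebra. If 𝓔: A-mod → A^σ-mod is a σ-Morita equivalence, then 𝓔 induces a dimension-preserving bijection between the set of isomorphism classes of simple A-modules and the set of isomorphism classes of simple A^σ-modules, and consequently A and A^σ are isomorphic as k-algebras. -/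
open CategoryTheory

universe u

/-- The `σ`-twist `A^σ` of a `k`-algebra `A`: the same ring, with scalar multiplication
`λ · x = σ⁻¹(λ) x`. -/
def Twist {k : Type u} [Field k] (σ : k ≃+* k) (A : Type u) : Type u := A

section Twist

variable {k : Type u} [Field k] (σ : k ≃+* k) (A : Type u) [Ring A] [Algebra k A]

instance : Ring (Twist σ A) := inferInstanceAs (Ring A)

instance : Algebra k (Twist σ A) := Algebra.compHom A σ.symm.toRingHom

variable {A}

/-- Any `A`-module is a module over `A^σ` (which is the same ring). -/
instance twistModule (V : Type u) [AddCommGroup V] [Module A V] : Module (Twist σ A) V :=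
  inferInstanceAs (Module A V)

/-- The `σ`-twist `V^σ` of an `A`-module `V`, as a module over `A^σ`. -/
def mtwistObj (V : ModuleCat.{u} A) : ModuleCat.{u} (Twist σ A) :=
  ModuleCat.of (Twist σ A) V

/-- A `k`-linear equivalence `𝓔 : A-mod ⥤ A^σ-mod` is a `σ`-Morita equivalence if
`𝓔(V) ≅ V^σ` for every simple `A`-module `V`. -/
def IsSigmaMoritaEquiv (E : ModuleCat.{u} A ≌ ModuleCat.{u} (Twist σ A)) : Prop :=
  ∃ _ : E.functor.Additive, E.functor.Linear k ∧
    ∀ V : ModuleCat.{u} A, IsSimpleModule A V →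
      Nonempty (E.functor.obj V ≅ mtwistObj σ V)

end Twist

attribute [local instance] ModuleCat.moduleOfAlgebraModule

section EssentialEpi

open CategoryTheory

universe w₁ w₂ v₁ v₂

variable {C : Type v₁} [Category.{w₁} C] {D : Type v₂} [Category.{w₂} D]

/-- An epimorphism `p` is essential if a morphism `f` is an epimorphism whenever `f ≫ p` is. -/
structure IsEssentialEpi {X Y : C} (p : X ⟶ Y) : Prop where
  epi : Epi p
  epi_of_comp : ∀ {Z : C} (f : Z ⟶ X), Epi (f ≫ p) → Epi f

theorem IsEssentialEpi.comp_iso {X Y Z : C} {p : X ⟶ Y} (hp : IsEssentialEpi p) (e : Y ≅ Z) :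
    IsEssentialEpi (p ≫ e.hom) where
  epi := by
    have := hp.epi
    infer_instance
  epi_of_comp f hf := by
    refine hp.epi_of_comp f ?_
    have : f ≫ p = (f ≫ p ≫ e.hom) ≫ e.inv := by simp
    rw [this]
    infer_instance

theorem IsEssentialEpi.map_equivalence {X Y : C} {p : X ⟶ Y} (hp : IsEssentialEpi p) (E : C ≌ D) :
    IsEssentialEpi (E.functor.map p) where
  epi := by
    have := hp.epi
    infer_instance
  epi_of_comp {Z} f hf := by
    let g : E.functor.obj (E.inverse.obj Z) ⟶ E.functor.obj X := E.counit.app Z ≫ f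
    have hg : E.functor.map (E.functor.preimage g) = g := E.functor.map_preimage g
    have h1 : Epi (E.functor.preimage g ≫ p) := by
      refine E.functor.epi_of_epi_map ?_
      rw [E.functor.map_comp, hg, Category.assoc]
      infer_instance
    have h2 := hp.epi_of_comp _ h1
    have h3 : Epi g := by
      rw [← hg]
      infer_instance
    exact epi_of_epi (E.counit.app Z) f

/-- Projective covers of the same object are isomorphic. -/
theorem IsEssentialEpi.nonempty_iso {P Q X : C} [Projective P] [Projective Q] {p : P ⟶ X}
    {q : Q ⟶ X} (hp : IsEssentialEpi p) (hq : IsEssentialEpi q) : Nonempty (P ≅ Q) := by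
  have := hp.epi
  have := hq.epi
  let f : P ⟶ Q := Projective.factorThru p q
  have hf : f ≫ q = p := Projective.factorThru_comp p q
  have hfe : Epi f := hq.epi_of_comp f (by rwa [hf])
  let g : Q ⟶ P := Projective.factorThru (𝟙 Q) f
  have hg : g ≫ f = 𝟙 Q := Projective.factorThru_comp (𝟙 Q) f
  have hge : Epi g := hp.epi_of_comp g (by
    rw [← hf, ← Category.assoc, hg, Category.id_comp]
    infer_instance)
  refine ⟨⟨f, g, ?_, hg⟩⟩
  rw [← cancel_epi g, ← Category.assoc, hg, Category.id_comp, Category.comp_id]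

end EssentialEpi

section ModuleCategories

open CategoryTheory Limits

universe v₁ v₂

theorem isEssentialEpi_mkQ_jacobson (R : Type u) [Ring R] :
    IsEssentialEpi (ModuleCat.ofHom (Module.jacobson R R).mkQ) where
  epi := (ModuleCat.epi_iff_surjective _).2 (Submodule.mkQ_surjective _)
  epi_of_comp {Z} f hf := by
    rw [ModuleCat.epi_iff_surjective] at hf
    rw [ModuleCat.epi_iff_range_eq_top]
    by_contra hne
    obtain ⟨m, hm, hle⟩ := Ideal.exists_le_maximal (f.hom.range : Ideal R) hne
    refine hm.ne_top ((Ideal.eq_top_iff_one m).2 ?_)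
    obtain ⟨z, hz⟩ := hf ((Module.jacobson R R).mkQ 1)
    have hz' : f.hom z - 1 ∈ Module.jacobson R R := (Submodule.Quotient.eq _).1 hz
    have h1 : f.hom z - 1 ∈ m := Ring.jacobson_le_of_isMaximal m hz'
    have h2 : f.hom z ∈ m := hle ⟨z, rfl⟩
    simpa using m.sub_mem h2 h1

theorem nonempty_iso_obj_of_isSemisimpleModule {R : Type u} [Ring R]
    {D : Type v₂} [Category.{v₁} D] [Preadditive D] [HasFiniteBiproducts D]
    (F G : ModuleCat.{u} R ⥤ D) [F.Additive] [G.Additive]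
    (h : ∀ V : ModuleCat.{u} R, IsSimpleModule R V → Nonempty (F.obj V ≅ G.obj V))
    (M : ModuleCat.{u} R) [IsSemisimpleModule R M] [Module.Finite R M] :
    Nonempty (F.obj M ≅ G.obj M) := by
  obtain ⟨n, S, e, hS⟩ := IsSemisimpleModule.exists_linearEquiv_fin_dfinsupp R M
  let T : Fin n → ModuleCat.{u} R := fun i => ModuleCat.of R (S i)
  have i₀ : M ≅ ⨁ T :=
    (e.trans (DFinsupp.linearEquivFunOnFintype (R := R))).toModuleIso ≪≫
      (ModuleCat.biproductIsoPi T).symm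
  have j : ∀ i, F.obj (T i) ≅ G.obj (T i) := fun i => (h (T i) (hS i)).some
  exact ⟨F.mapIso i₀ ≪≫ F.mapBiproduct T ≪≫ biproduct.mapIso j ≪≫
    (G.mapBiproduct T).symm ≪≫ (G.mapIso i₀).symm⟩

/-- Two equivalences of module categories over an Artinian ring which agree on simple modules
agree on the regular module. -/
theorem nonempty_iso_obj_self {R : Type u} [Ring R] [IsArtinianRing R]
    {D : Type v₂} [Category.{v₁} D] [Preadditive D] [HasFiniteBiproducts D]
    (E F : ModuleCat.{u} R ≌ D) [E.functor.Additive] [F.functor.Additive]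
    (h : ∀ V : ModuleCat.{u} R, IsSimpleModule R V →
      Nonempty (E.functor.obj V ≅ F.functor.obj V)) :
    Nonempty (E.functor.obj (ModuleCat.of R R) ≅ F.functor.obj (ModuleCat.of R R)) := by
  have : IsSemisimpleModule R (R ⧸ Module.jacobson R R) :=
    (IsArtinian.isSemisimpleModule_iff_jacobson R _).2 (Module.jacobson_quotient_jacobson R R)
  obtain ⟨i⟩ := nonempty_iso_obj_of_isSemisimpleModule E.functor F.functor h
    (ModuleCat.of R (R ⧸ Module.jacobson R R))
  have hR := isEssentialEpi_mkQ_jacobson R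
  have hP : Projective (ModuleCat.of R R) := ModuleCat.projective_of_categoryTheory_projective _
  have := (E.map_projective_iff _).2 hP
  have := (F.map_projective_iff _).2 hP
  exact ((hR.map_equivalence E).comp_iso i).nonempty_iso (hR.map_equivalence F)

/-- A linear functor preserves the action of scalars. -/
theorem map_hom_apply_eq_algebraMap_smul {k : Type u} [Field k] {A B : Type u} [Ring A]
    [Algebra k A] [Ring B] [Algebra k B] (F : ModuleCat.{u} A ⥤ ModuleCat.{u} B)
    [F.Additive] [F.Linear k] (c : k) {V : ModuleCat.{u} A} (f : V ⟶ V)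
    (hf : ∀ x : V, f.hom x = algebraMap k A c • x) (y : F.obj V) :
    (F.map f).hom y = algebraMap k B c • y := by
  have hfc : f = c • 𝟙 V := ModuleCat.hom_ext (LinearMap.ext hf)
  have h : F.map (c • 𝟙 V) = c • F.map (𝟙 V) := F.map_smul c (𝟙 V)
  rw [hfc, h, F.map_id]
  rfl

theorem nonempty_algEquiv_of_iso_obj_self {k : Type u} [Field k] {A B : Type u} [Ring A]
    [Algebra k A] [Ring B] [Algebra k B] (F : ModuleCat.{u} A ⥤ ModuleCat.{u} B)
    [F.Full] [F.Faithful] [F.Additive] [F.Linear k]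
    (i : F.obj (ModuleCat.of A A) ≅ ModuleCat.of B B) : Nonempty (A ≃ₐ[k] B) := by
  let r : A → (ModuleCat.of A A ⟶ ModuleCat.of A A) :=
    fun a => ModuleCat.ofHom (LinearMap.toSpanSingleton A A a)
  have r_apply : ∀ a b : A, (r a).hom b = b * a := fun a b => rfl
  let G : A → (ModuleCat.of B B ⟶ ModuleCat.of B B) := fun a => i.inv ≫ F.map (r a) ≫ i.hom
  have G_apply : ∀ a (b : B), (G a).hom b = b * (G a).hom (1 : B) := fun a b => by
    simpa using (G a).hom.map_smul b (1 : B)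
  have r_mul : ∀ a b, r (a * b) = r a ≫ r b := fun a b =>
    ModuleCat.hom_ext (LinearMap.ext fun x => (mul_assoc (x : A) a b).symm)
  have r_add : ∀ a b, r (a + b) = r a + r b := fun a b =>
    ModuleCat.hom_ext (LinearMap.ext fun x => mul_add (x : A) a b)
  have G_mul : ∀ a b, G (a * b) = G a ≫ G b := fun a b => by simp [G, r_mul]
  have G_add : ∀ a b, G (a + b) = G a + G b := fun a b => by
    simp [G, r_add, F.map_add]
  have hmap : ∀ c : k, (G (algebraMap k A c)).hom (1 : B) = algebraMap k B c := fun c => by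
    have h1 : (F.map (r (algebraMap k A c))).hom (i.inv.hom (1 : B)) =
        algebraMap k B c • i.inv.hom (1 : B) :=
      map_hom_apply_eq_algebraMap_smul F c _ (fun x => (Algebra.commutes c (x : A)).symm) _
    have h2 : i.hom.hom (i.inv.hom (1 : B)) = (1 : B) := by simp
    change i.hom.hom ((F.map (r (algebraMap k A c))).hom (i.inv.hom (1 : B))) = _
    rw [h1, map_smul, h2]
    exact mul_one _
  let φ : A →ₐ[k] B :=
    { toFun := fun a => (G a).hom (1 : B)
      map_one' := by simpa using hmap 1
      map_zero' := by simpa using hmap 0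
      map_mul' := fun a b => by
        rw [G_mul]
        exact G_apply b _
      map_add' := fun a b => by
        rw [G_add]
        rfl
      commutes' := hmap }
  refine ⟨AlgEquiv.ofBijective φ ⟨fun a b hab => ?_, fun b => ?_⟩⟩
  · have hG : G a = G b := ModuleCat.hom_ext (LinearMap.ext_ring hab)
    have hF : F.map (r a) = F.map (r b) := by simpa [G] using hG
    have hr := F.map_injective hF
    have h1 : (r a).hom (1 : A) = (r b).hom (1 : A) := by rw [hr]
    simpa only [r_apply, one_mul] using h1
  · let g : ModuleCat.of B B ⟶ ModuleCat.of B B :=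
      ModuleCat.ofHom (LinearMap.toSpanSingleton B B b)
    let f := F.preimage (i.hom ≫ g ≫ i.inv)
    refine ⟨f.hom (1 : A), ?_⟩
    have hr : r (f.hom (1 : A)) = f := ModuleCat.hom_ext (LinearMap.ext_ring (one_mul _))
    have hG : G (f.hom (1 : A)) = g := by simp [G, hr, f]
    change (G (f.hom (1 : A))).hom (1 : B) = b
    rw [hG]
    exact one_mul b

end ModuleCategories

section TwistFunctor

variable {k : Type u} [Field k] (σ : k ≃+* k) (A : Type u) [Ring A]

/-- The functor `V ↦ V^σ`, as an equivalence of categories. -/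
def mtwistEquivalence : ModuleCat.{u} A ≌ ModuleCat.{u} (Twist σ A) :=
  CategoryTheory.Equivalence.refl (C := ModuleCat.{u} A)

instance : (mtwistEquivalence σ A).functor.Additive where
  map_add := rfl

variable {A} [Algebra k A]

theorem finrank_mtwistObj (V : ModuleCat.{u} A) :
    Module.finrank k (mtwistObj σ V) = Module.finrank k V := by
  refine congrArg Cardinal.toNat (rank_eq_of_equiv_equiv (M := mtwistObj σ V) (M₁ := V)
    σ.symm (AddEquiv.refl V) σ.symm.bijective fun c m => rfl)

end TwistFunctor

/-- A `σ`-Morita equivalence `𝓔 : A-mod → A^σ-mod` induces a dimension-preserving bijection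
between the isomorphism classes of simple `A`-modules and of simple `A^σ`-modules, and
consequently `A` and `A^σ` are isomorphic as `k`-algebras. -/
theorem sigmaMoritaEquiv_bijection_and_algEquiv
    {k : Type u} [Field k] [IsAlgClosed k] (σ : k ≃+* k)
    {A : Type u} [Ring A] [Algebra k A] [FiniteDimensional k A]
    (E : ModuleCat.{u} A ≌ ModuleCat.{u} (Twist σ A))
    (hE : IsSigmaMoritaEquiv σ E) :
    (∀ V : ModuleCat.{u} A, IsSimpleModule A V →
        IsSimpleModule (Twist σ A) (E.functor.obj V) ∧
          Module.finrank k (E.functor.obj V) = Module.finrank k V) ∧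
    (∀ V V' : ModuleCat.{u} A, IsSimpleModule A V → IsSimpleModule A V' →
        Nonempty (E.functor.obj V ≅ E.functor.obj V') → Nonempty (V ≅ V')) ∧
    (∀ W : ModuleCat.{u} (Twist σ A), IsSimpleModule (Twist σ A) W →
        ∃ V : ModuleCat.{u} A, IsSimpleModule A V ∧ Nonempty (E.functor.obj V ≅ W)) ∧
    Nonempty (A ≃ₐ[k] Twist σ A) := by
  obtain ⟨hadd, hlin, hV⟩ := hE
  have hsimple : ∀ V : ModuleCat.{u} A, IsSimpleModule A V →
      IsSimpleModule (Twist σ A) (mtwistObj σ V) := fun _ h => h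
  refine ⟨fun V hs => ?_, fun V V' _ _ ⟨i⟩ => ⟨E.functor.preimageIso i⟩, fun W hs => ?_, ?_⟩
  · obtain ⟨i⟩ := hV V hs
    have := hsimple V hs
    refine ⟨IsSimpleModule.congr i.toLinearEquiv, ?_⟩
    rw [← finrank_mtwistObj σ V]
    have := ModuleCat.isScalarTower_of_algebra_moduleCat (k := k) (E.functor.obj V)
    have := ModuleCat.isScalarTower_of_algebra_moduleCat (k := k) (mtwistObj σ V)
    exact (i.toLinearEquiv.restrictScalars k).finrank_eq
  · exact ⟨(mtwistEquivalence σ A).inverse.obj W, hs,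
      hV ((mtwistEquivalence σ A).inverse.obj W) hs⟩
  · have : IsArtinianRing A := IsArtinianRing.of_finite k A
    obtain ⟨i⟩ := nonempty_iso_obj_self E (mtwistEquivalence σ A) hV
    exact nonempty_algEquiv_of_iso_obj_self E.functor i
end

section
/- Let p be a prime, k = F̄_p an algebraic closure of the field of p elements, and σ: k → k the Frobenius automorphism λ ↦ λ^p. For every finite-dimensional k-algebra A there exists a positive integer m such that A and A^{σ^m} are σ^m-Morita equivalent; hence the σ-Morita Frobenius number of A is well-defined. -/
open CategoryTheory

universe u

attribute [local instance] HasDerivedCategory.standard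

/-- `A` and `A^σ` are `σ`-Morita equivalent. -/
def SigmaMoritaEquivalent {k : Type u} [Field k] (σ : k ≃+* k) (A : Type u) [Ring A]
    [Algebra k A] : Prop :=
  ∃ E : ModuleCat.{u} A ≌ ModuleCat.{u} (Twist σ A), IsSigmaMoritaEquiv σ E
/-- The `σ`-Morita Frobenius number of `A`: the least positive integer `m` such that `A` and
`A^{σ^m}` are `σ^m`-Morita equivalent, where `σ` is the Frobenius automorphism `λ ↦ λ^p`. -/
noncomputable def SigmaMoritaFrobeniusNumber (p : ℕ) [Fact p.Prime] (k : Type u) [Field k]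
    [IsAlgClosed k] [CharP k p] (A : Type u) [Ring A] [Algebra k A] : ℕ :=
  sInf {m : ℕ | 0 < m ∧
    SigmaMoritaEquivalent (((frobeniusEquiv k p : RingAut k) ^ m : RingAut k) : k ≃+* k) A}

/-- Every element of an algebraic extension of the prime field is fixed by a positive power of
the Frobenius automorphism. -/
theorem exists_frobeniusEquiv_pow_apply_eq (p : ℕ) [Fact p.Prime] (k : Type u) [Field k]
    [Algebra (ZMod p) k] [Algebra.IsAlgebraic (ZMod p) k] [CharP k p] [PerfectRing k p] (x : k) :
    ∃ n : ℕ, 0 < n ∧ ((frobeniusEquiv k p : RingAut k) ^ n) x = x := by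
  have hfd : FiniteDimensional (ZMod p) (IntermediateField.adjoin (ZMod p) {x}) :=
    IntermediateField.adjoin.finiteDimensional (Algebra.IsIntegral.isIntegral x)
  have hfin : Finite (IntermediateField.adjoin (ZMod p) {x}) := Module.finite_of_finite (ZMod p)
  let _ : Fintype (IntermediateField.adjoin (ZMod p) {x}) := Fintype.ofFinite _
  have hp : CharP (IntermediateField.adjoin (ZMod p) {x}) p :=
    charP_of_injective_algebraMap (algebraMap (ZMod p) _).injective p
  obtain ⟨n, -, hn⟩ := FiniteField.card (IntermediateField.adjoin (ZMod p) {x}) p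
  refine ⟨n, n.2, ?_⟩
  have key := congrArg Subtype.val
    (FiniteField.pow_card (IntermediateField.AdjoinSimple.gen (ZMod p) x))
  rw [hn] at key
  have hpow : ∀ m : ℕ, ((frobeniusEquiv k p : RingAut k) ^ m) x = x ^ p ^ m := by
    intro m
    induction m with
    | zero => simp
    | succ m ih =>
      rw [pow_succ', RingAut.mul_apply, ih, pow_succ, pow_mul]
      rfl
  rw [hpow]
  exact key

section Periodic

variable {k : Type u} [Field k] {σ : RingAut k}

theorem pow_apply_eq_of_dvd {x : k} {n m : ℕ} (hx : (σ ^ n) x = x) (h : n ∣ m) :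
    (σ ^ m) x = x := by
  obtain ⟨d, rfl⟩ := h
  rw [pow_mul]
  induction d with
  | zero => simp
  | succ d ih => rw [pow_succ, RingAut.mul_apply, hx, ih]

theorem exists_forall_dvd_pow_apply_eq (hσ : ∀ x : k, ∃ n : ℕ, 0 < n ∧ (σ ^ n) x = x)
    {ι : Type*} [Finite ι] (x : ι → k) :
    ∃ n : ℕ, 0 < n ∧ ∀ m, n ∣ m → ∀ i, (σ ^ m) (x i) = x i := by
  let _ : Fintype ι := Fintype.ofFinite ι
  choose n hn h using hσ
  exact ⟨∏ i, n (x i), Finset.prod_pos fun i _ => hn _, fun m hm i =>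
    pow_apply_eq_of_dvd (h (x i)) ((Finset.dvd_prod_of_mem _ (Finset.mem_univ i)).trans hm)⟩

/-- The additive automorphism of `V` applying `τ` to the coordinates in the basis `c`. -/
noncomputable def Module.Basis.mapCoords {V ι : Type*} [AddCommGroup V] [Module k V] [Fintype ι]
    (c : Module.Basis ι k V) (τ : RingAut k) : V ≃+ V :=
  (c.equivFun.toAddEquiv.trans (AddEquiv.piCongrRight fun _ => RingEquiv.toAddEquiv τ)).trans
    c.equivFun.symm.toAddEquiv

section MapCoords

variable {V ι : Type*} [AddCommGroup V] [Module k V] [Fintype ι] (c : Module.Basis ι k V)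
  (τ : RingAut k)

theorem Module.Basis.equivFun_mapCoords (v : V) (i : ι) :
    c.equivFun (c.mapCoords τ v) i = τ (c.equivFun v i) := by
  change c.equivFun (c.equivFun.symm fun i => τ (c.equivFun v i)) i = _
  rw [LinearEquiv.apply_symm_apply]

theorem Module.Basis.mapCoords_smul (a : k) (v : V) :
    c.mapCoords τ (a • v) = τ a • c.mapCoords τ v := by
  apply c.equivFun.injective
  ext i
  rw [c.equivFun_mapCoords, map_smul, map_smul, Pi.smul_apply, Pi.smul_apply,
    c.equivFun_mapCoords, smul_eq_mul, smul_eq_mul, map_mul]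

theorem Module.Basis.mapCoords_eq_self {v : V} (h : ∀ i, τ (c.equivFun v i) = c.equivFun v i) :
    c.mapCoords τ v = v := by
  apply c.equivFun.injective
  ext i
  rw [c.equivFun_mapCoords, h]

theorem Module.Basis.mapCoords_self (j : ι) : c.mapCoords τ (c j) = c j := by
  classical
  refine c.mapCoords_eq_self τ fun i => ?_
  rw [c.equivFun_self]
  split_ifs <;> simp

theorem Module.Basis.mapCoords_comm (T : V →ₗ[k] V)
    (h : ∀ i j, τ (c.equivFun (T (c j)) i) = c.equivFun (T (c j)) i) (v : V) :
    c.mapCoords τ (T v) = T (c.mapCoords τ v) := by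
  rw [← c.sum_equivFun v]
  simp only [map_sum, map_smul, c.mapCoords_smul, c.mapCoords_self]
  exact Finset.sum_congr rfl fun j _ => by rw [c.mapCoords_eq_self τ fun i => h i j]

end MapCoords

theorem Module.Basis.exists_mapCoords_smul
    (hσ : ∀ x : k, ∃ n : ℕ, 0 < n ∧ (σ ^ n) x = x)
    {A : Type*} [Ring A] [Algebra k A] {κ : Type*} [Fintype κ] (b : Module.Basis κ k A)
    {V ι : Type*} [AddCommGroup V] [Module k V] [Module A V] [IsScalarTower k A V] [Fintype ι]
    (c : Module.Basis ι k V) :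
    ∃ n : ℕ, 0 < n ∧ ∀ m, n ∣ m → ∀ (a : A) (v : V),
      c.mapCoords (σ ^ m) (a • v) = b.mapCoords (σ ^ m) a • c.mapCoords (σ ^ m) v := by
  obtain ⟨n, hn, h⟩ := exists_forall_dvd_pow_apply_eq hσ
    fun x : κ × ι × ι => c.equivFun (b x.1 • c x.2.2) x.2.1
  refine ⟨n, hn, fun m hm a v => ?_⟩
  have hb : ∀ l, c.mapCoords (σ ^ m) (b l • v) = b l • c.mapCoords (σ ^ m) v := fun l =>
    c.mapCoords_comm (σ ^ m) (Algebra.lsmul k k V (b l)) (fun i j => h m hm (l, i, j)) v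
  conv_lhs => rw [← b.sum_equivFun a]
  conv_rhs => rw [← b.sum_equivFun a]
  simp only [Finset.sum_smul, map_sum, smul_assoc, Module.Basis.mapCoords_smul, hb,
    Module.Basis.mapCoords_self]

/-- All simple quotients of a module of finite length are simultaneously isomorphic to their
twists by a suitable power of `σ`. -/
theorem IsFiniteLength.exists_addEquiv_smul
    (hσ : ∀ x : k, ∃ n : ℕ, 0 < n ∧ (σ ^ n) x = x)
    {A : Type*} [Ring A] [Algebra k A] [FiniteDimensional k A]
    {κ : Type*} [Fintype κ] (b : Module.Basis κ k A)
    {M : Type*} [AddCommGroup M] [Module A M] (hM : IsFiniteLength A M) :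
    ∃ n : ℕ, 0 < n ∧ ∀ m, n ∣ m → ∀ (V : Type u) [AddCommGroup V] [Module A V]
      [IsSimpleModule A V] (g : M →ₗ[A] V), Function.Surjective g →
      ∃ f : V ≃+ V, ∀ (a : A) (v : V), f (a • v) = b.mapCoords (σ ^ m) a • f v := by
  induction hM with
  | of_subsingleton =>
    refine ⟨1, one_pos, fun m _ V _ _ _ g hg => ?_⟩
    have := IsSimpleModule.nontrivial A V
    exact absurd hg.subsingleton (not_subsingleton V)
  | @of_simple_quotient M _ _ N _ _ ih =>
    obtain ⟨n₁, hn₁, h₁⟩ := ih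
    let _ : Module k (M ⧸ N) := Module.compHom _ (algebraMap k A)
    have _ : IsScalarTower k A (M ⧸ N) := IsScalarTower.of_algebraMap_smul fun _ _ => rfl
    have _ : FiniteDimensional k (M ⧸ N) := Module.Finite.trans A _
    obtain ⟨n₂, hn₂, h₂⟩ := b.exists_mapCoords_smul hσ (Module.finBasis k (M ⧸ N))
    refine ⟨n₁ * n₂, Nat.mul_pos hn₁ hn₂, fun m hm V _ _ _ g hg => ?_⟩
    rcases LinearMap.surjective_or_eq_zero (g.comp N.subtype) with hs | hz
    · exact h₁ m ((dvd_mul_right _ _).trans hm) V _ hs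
    · have hle : N ≤ LinearMap.ker g := fun x hx => LinearMap.congr_fun hz ⟨x, hx⟩
      have := IsSimpleModule.nontrivial A V
      have hsurj : Function.Surjective (N.liftQ g hle) := fun v => by
        obtain ⟨x, rfl⟩ := hg v
        exact ⟨N.mkQ x, by simp⟩
      let e : (M ⧸ N) ≃ₗ[A] V := LinearEquiv.ofBijective (N.liftQ g hle)
        ((LinearMap.bijective_or_eq_zero _).resolve_right fun h0 => by
          obtain ⟨v, hv⟩ := exists_ne (0 : V)
          obtain ⟨y, rfl⟩ := hsurj v
          exact hv (by rw [h0]; rfl))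
      refine ⟨(e.symm.toAddEquiv.trans
        ((Module.finBasis k (M ⧸ N)).mapCoords (σ ^ m))).trans e.toAddEquiv, fun a v => ?_⟩
      simp [h₂ m ((dvd_mul_left _ _).trans hm)]

/-- If every element of `k` is `σ`-periodic, then a finite-dimensional algebra is
`σ ^ m`-Morita equivalent to its twist by `σ ^ m` for some positive `m`. -/
theorem exists_sigmaMoritaEquivalent_pow
    (hσ : ∀ x : k, ∃ n : ℕ, 0 < n ∧ (σ ^ n) x = x)
    (A : Type u) [Ring A] [Algebra k A] [FiniteDimensional k A] :
    ∃ m : ℕ, 0 < m ∧ SigmaMoritaEquivalent ((σ ^ m : RingAut k) : k ≃+* k) A := by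
  let b := Module.finBasis k A
  obtain ⟨n₁, hn₁, h₁⟩ := b.exists_mapCoords_smul hσ b
  have _ : IsArtinianRing A := IsArtinianRing.of_finite k A
  have _ : IsNoetherianRing A := IsNoetherianRing.of_finite k A
  obtain ⟨n₂, hn₂, h₂⟩ := IsFiniteLength.exists_addEquiv_smul hσ b
    (isFiniteLength_iff_isNoetherian_isArtinian.mpr ⟨‹_›, ‹_›⟩ : IsFiniteLength A A)
  refine ⟨n₁ * n₂, Nat.mul_pos hn₁ hn₂, ?_⟩
  replace h₁ := h₁ _ (dvd_mul_right n₁ n₂)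
  replace h₂ := h₂ _ (dvd_mul_left n₂ n₁)
  generalize σ ^ (n₁ * n₂) = τ at h₁ h₂ ⊢
  let Φ : A ≃+* A := { b.mapCoords τ with map_mul' := h₁ }
  have hΦ : ∀ (c : k) (a : A), Φ (c • a) = τ c • Φ a := b.mapCoords_smul τ
  let e : Twist τ A ≃ₐ[k] A :=
    AlgEquiv.ofRingEquiv (f := (Φ : Twist τ A ≃+* A)) fun c => by
      change Φ (algebraMap k A (τ.symm c)) = algebraMap k A c
      rw [Algebra.algebraMap_eq_smul_one, hΦ, map_one, Algebra.algebraMap_eq_smul_one]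
      congr 1
      exact τ.apply_symm_apply c
  refine ⟨ModuleCat.restrictScalarsEquivalenceOfRingEquiv e.toRingEquiv, inferInstance,
    ?_, fun V hV => ?_⟩
  · exact ModuleCat.Algebra.restrictScalarsEquivalenceOfRingEquiv_linear e
  · have := IsSimpleModule.nontrivial A V
    obtain ⟨v, hv⟩ := exists_ne (0 : V)
    obtain ⟨f, hf⟩ := h₂ V (LinearMap.toSpanSingleton A V v)
      (IsSimpleModule.toSpanSingleton_surjective A hv)
    let E : (ModuleCat.restrictScalars (e.toRingEquiv : Twist τ A →+* A)).obj V ≃ₗ[Twist τ A]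
        mtwistObj τ V :=
      { (f.symm : V ≃+ V) with
        map_smul' := fun a (w : V) => by
          change f.symm (b.mapCoords τ a • w) = (a : A) • f.symm w
          exact (AddEquiv.symm_apply_eq f).mpr
            ((hf a (f.symm w)).trans (by rw [AddEquiv.apply_symm_apply])).symm }
    exact ⟨E.toModuleIso⟩

end Periodic

/-- For `k = 𝔽̄_p` with Frobenius automorphism `σ`, every finite-dimensional `k`-algebra `A`
admits a positive integer `m` such that `A` and `A^{σ^m}` are `σ^m`-Morita equivalent; hence
the `σ`-Morita Frobenius number of `A` is well-defined (it is positive and realises a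
`σ`-Morita equivalence). -/
theorem sigmaMoritaFrobeniusNumber_exists
    (p : ℕ) [Fact p.Prime] (k : Type u) [Field k] [Algebra (ZMod p) k]
    [IsAlgClosure (ZMod p) k] [IsAlgClosed k] [CharP k p]
    (A : Type u) [Ring A] [Algebra k A] [FiniteDimensional k A] :
    (∃ m : ℕ, 0 < m ∧
        SigmaMoritaEquivalent (((frobeniusEquiv k p : RingAut k) ^ m : RingAut k) : k ≃+* k) A) ∧
      0 < SigmaMoritaFrobeniusNumber p k A ∧
      SigmaMoritaEquivalent
        (((frobeniusEquiv k p : RingAut k) ^ (SigmaMoritaFrobeniusNumber p k A) :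
          RingAut k) : k ≃+* k) A := by
  have hex := exists_sigmaMoritaEquivalent_pow
    (exists_frobeniusEquiv_pow_apply_eq p k) A
  exact ⟨hex, Nat.sInf_mem hex⟩
end

section
/- Let p be a prime, k = F̄_p an algebraic closure of the field of p elements, and σ: k → k the Frobenius automorphism λ ↦ λ^p. Let m be a positive integer, let k₀ ⊆ k be the subfield with p^m elements, and let A₀ be a finite-dimensional k₀-algebra which is split over k₀ (i.e. the endomorphism algebra of every simple A₀-module equals k₀). Then the k-algebra A = k ⊗_{k₀} A₀ and A^{σ^m} are σ^m-Morita equivalent; in particular, the σ-Morita Frobenius number of A is at most m. -/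
open CategoryTheory

universe u

attribute [local instance] HasDerivedCategory.standard

section SplitAlgebra

variable {k₀ A₀ : Type u} [Field k₀] [Ring A₀] [Algebra k₀ A₀]

/-- If the endomorphisms of a simple module are the scalars, then every linear endomorphism
agrees on a given finite set with multiplication by an element of the algebra. -/
theorem exists_smul_eq_of_end_eq_scalars {M : Type u} [AddCommGroup M] [Module A₀ M]
    [Module k₀ M] [IsScalarTower k₀ A₀ M] [IsSimpleModule A₀ M]
    (hM : ∀ f : M →ₗ[A₀] M, ∃ c : k₀, ∀ v : M, f v = algebraMap k₀ A₀ c • v)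
    (g : M →ₗ[k₀] M) (s : Finset M) : ∃ a : A₀, ∀ v ∈ s, g v = a • v := by
  let g' : Module.End (Module.End A₀ M) M :=
    { toFun := g
      map_add' := g.map_add
      map_smul' := fun f v ↦ by
        obtain ⟨c, hc⟩ := hM f
        simp [Module.End.smul_def, hc] }
  exact jacobson_density g' s

/-- A nontrivial module over a finite-dimensional algebra receives an injection from a simple
module. -/
theorem exists_simple_injective [FiniteDimensional k₀ A₀] (V : Type u) [AddCommGroup V]
    [Module A₀ V] [Nontrivial V] :
    ∃ (M : ModuleCat.{u} A₀) (j : M →ₗ[A₀] V), IsSimpleModule A₀ M ∧ Module.Finite A₀ M ∧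
      Function.Injective j := by
  have : IsArtinianRing A₀ := IsArtinianRing.of_finite k₀ A₀
  obtain ⟨v, hv⟩ := exists_ne (0 : V)
  let N := Submodule.span A₀ {v}
  have : IsArtinian A₀ N := inferInstance
  have hN : (⊤ : Submodule A₀ N) ≠ ⊥ := by
    rw [Ne, Submodule.eq_bot_iff]
    intro h
    exact hv (congrArg Subtype.val
      (h ⟨v, Submodule.mem_span_singleton_self v⟩ Submodule.mem_top))
  obtain ⟨S, hS, -⟩ := (eq_bot_or_exists_atom_le (⊤ : Submodule A₀ N)).resolve_left hN
  have hS' : IsSimpleModule A₀ S := isSimpleModule_iff_isAtom.mpr hS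
  exact ⟨ModuleCat.of A₀ S, N.subtype ∘ₗ S.subtype, hS', inferInstanceAs (Module.Finite A₀ S),
    N.injective_subtype.comp S.injective_subtype⟩

/-- Let `A₀` be a split finite-dimensional `k₀`-algebra, `k` an extension of `k₀` and `V` a
simple `k ⊗ A₀`-module. Every field automorphism of `k` fixing `k₀` lifts to a semilinear
automorphism of `V` commuting with `A₀`. -/
theorem exists_semilinear_addEquiv [FiniteDimensional k₀ A₀] {k : Type u} [Field k]
    [Algebra k₀ k]
    (hsplit : ∀ V : ModuleCat.{u} A₀, IsSimpleModule A₀ V →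
      ∀ f : V →ₗ[A₀] V, ∃ c : k₀, ∀ v : V, f v = algebraMap k₀ A₀ c • v)
    (φ : k ≃ₐ[k₀] k) (V : Type u) [AddCommGroup V] [Module k V] [Module A₀ V] [Module k₀ V]
    [IsScalarTower k₀ A₀ V] [IsScalarTower k₀ k V] [SMulCommClass A₀ k V] [Nontrivial V]
    (hV : ∀ W : Submodule k V, (∀ (a : A₀), ∀ w ∈ W, a • w ∈ W) → W ≠ ⊥ → W = ⊤) :
    ∃ ψ : V ≃+ V, (∀ (c : k) (v : V), ψ (c • v) = φ c • ψ v) ∧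
      ∀ (a : A₀) (v : V), ψ (a • v) = a • ψ v := by
  obtain ⟨M, j, hM, hfin, hj⟩ := exists_simple_injective (k₀ := k₀) (A₀ := A₀) V
  let : Module k₀ M := Module.compHom M (algebraMap k₀ A₀)
  have : IsScalarTower k₀ A₀ M := ⟨fun c a v ↦ by
    change (c • a) • v = algebraMap k₀ A₀ c • (a • v)
    rw [Algebra.smul_def, mul_smul]⟩
  have : Module.Finite k₀ M := Module.Finite.trans A₀ M
  let j₀ : M →ₗ[k₀] V := j.restrictScalars k₀
  let b := Module.finBasis k₀ M
  have hli : LinearIndependent k (fun i ↦ j (b i)) := by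
    rw [Fintype.linearIndependent_iff]
    intro g hg i
    classical
    obtain ⟨a, ha⟩ := exists_smul_eq_of_end_eq_scalars (k₀ := k₀) (hsplit M hM)
      (b.constr k₀ (Pi.single i (b i))) (Finset.univ.image b)
    have ha' (l) : a • b l = Pi.single (M := fun _ ↦ (M : Type u)) i (b i) l := by
      rw [← ha _ (by simp), b.constr_basis]
    have h := congrArg (a • ·) hg
    simp only [Finset.smul_sum, smul_zero, smul_comm a, ← map_smul j, ha'] at h
    rw [Finset.sum_eq_single i (fun l _ hl ↦ by simp [Pi.single_eq_of_ne hl]) (by simp),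
      Pi.single_eq_same] at h
    exact (smul_eq_zero.mp h).resolve_right fun h0 ↦
      b.ne_zero i (hj (h0.trans (map_zero j).symm))
  have hexp (x : M) : j x = ∑ i, algebraMap k₀ k (b.repr x i) • j (b i) := by
    conv_lhs => rw [← b.sum_repr x]
    change j₀ _ = _
    rw [map_sum]
    exact Finset.sum_congr rfl fun i _ ↦ by rw [map_smul, algebraMap_smul]; rfl
  have hspan : ⊤ ≤ Submodule.span k (Set.range fun i ↦ j (b i)) := by
    refine (hV _ (fun a w hw ↦ ?_) fun h ↦ ?_).ge
    · induction hw using Submodule.span_induction with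
      | mem x hx =>
        obtain ⟨i, rfl⟩ := hx
        rw [← map_smul, hexp]
        exact Submodule.sum_mem _ fun l _ ↦
          Submodule.smul_mem _ _ (Submodule.subset_span ⟨l, rfl⟩)
      | zero => simp
      | add x y _ _ hx hy => rw [smul_add]; exact add_mem hx hy
      | smul c x _ hx => rw [smul_comm]; exact Submodule.smul_mem _ _ hx
    · have : Nontrivial M := IsSimpleModule.nontrivial A₀ M
      obtain ⟨x, hx⟩ := exists_ne (0 : M)
      refine hx (hj ?_)
      rw [map_zero, hexp]
      refine Finset.sum_eq_zero fun i _ ↦ ?_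
      have h0 : j (b i) = 0 :=
        (Submodule.eq_bot_iff _).mp h _ (Submodule.subset_span ⟨i, rfl⟩)
      rw [h0, smul_zero]
  let B := Module.Basis.mk hli hspan
  let ψ : V ≃+ V := (B.equivFun.toAddEquiv.trans
    (AddEquiv.piCongrRight fun _ ↦ φ.toRingEquiv.toAddEquiv)).trans B.equivFun.symm.toAddEquiv
  have hψ (v : V) : ψ v = ∑ i, φ (B.equivFun v i) • B i := by
    change B.equivFun.symm _ = _
    rw [B.equivFun_symm_apply]
    rfl
  have hsmul (c : k) (v : V) : ψ (c • v) = φ c • ψ v := by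
    simp [hψ, Finset.smul_sum, mul_smul]
  have hB (i) : ψ (B i) = B i := by
    rw [hψ]
    simp [B.equivFun_self]
  have hψj (x : M) : ψ (j x) = j x := by
    rw [hexp, map_sum]
    refine Finset.sum_congr rfl fun i _ ↦ ?_
    have : j (b i) = B i := (Module.Basis.mk_apply hli hspan i).symm
    rw [hsmul, φ.commutes, this, hB]
  refine ⟨ψ, hsmul, fun a v ↦ ?_⟩
  have hv : v ∈ Submodule.span k (Set.range fun i ↦ j (b i)) := hspan trivial
  induction hv using Submodule.span_induction with
  | mem x hx =>
    obtain ⟨i, rfl⟩ := hx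
    rw [← map_smul, hψj, hψj, map_smul]
  | zero => simp
  | add x y _ _ hx hy => rw [smul_add, map_add, map_add, hx, hy, smul_add]
  | smul c x _ hx => rw [smul_comm a, hsmul, hx, hsmul, smul_comm a]

open TensorProduct in
/-- A simple `k ⊗ A₀`-module over a split form `A₀` is isomorphic to its twist by an automorphism
of `k` fixing `k₀`. -/
theorem exists_addEquiv_map_smul [FiniteDimensional k₀ A₀] {k : Type u} [Field k]
    [Algebra k₀ k]
    (hsplit : ∀ V : ModuleCat.{u} A₀, IsSimpleModule A₀ V →
      ∀ f : V →ₗ[A₀] V, ∃ c : k₀, ∀ v : V, f v = algebraMap k₀ A₀ c • v)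
    (φ : k ≃ₐ[k₀] k) (V : Type u) [AddCommGroup V] [Module (k ⊗[k₀] A₀) V]
    [IsSimpleModule (k ⊗[k₀] A₀) V] :
    ∃ ψ : V ≃+ V, ∀ (a : k ⊗[k₀] A₀) (v : V),
      ψ (a • v) = Algebra.TensorProduct.congr φ (AlgEquiv.refl : A₀ ≃ₐ[k₀] A₀) a • ψ v := by
  let : Module k V := Module.compHom V (algebraMap k (k ⊗[k₀] A₀))
  let : Module A₀ V := Module.compHom V
    (Algebra.TensorProduct.includeRight : A₀ →ₐ[k₀] k ⊗[k₀] A₀).toRingHom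
  let : Module k₀ V := Module.compHom V (algebraMap k₀ k)
  have hk (c : k) (v : V) : c • v = (c ⊗ₜ[k₀] (1 : A₀)) • v := rfl
  have hA (a : A₀) (v : V) : a • v = ((1 : k) ⊗ₜ[k₀] a) • v := rfl
  have hk₀ (c : k₀) (v : V) : c • v = algebraMap k₀ k c • v := rfl
  have htmul (c : k) (a : A₀) (v : V) : (c ⊗ₜ[k₀] a) • v = c • a • v := by
    rw [hk, hA, ← mul_smul]; simp
  have : IsScalarTower k₀ k V := ⟨fun c d v ↦ by
    rw [hk₀, Algebra.smul_def, mul_smul]⟩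
  have : SMulCommClass A₀ k V := ⟨fun a c v ↦ by
    rw [hA, hA, hk, hk, ← mul_smul, ← mul_smul]; simp⟩
  have : IsScalarTower k₀ A₀ V := ⟨fun c a v ↦ by
    rw [hk₀, hA, hA, hk, ← mul_smul, Algebra.TensorProduct.tmul_mul_tmul, mul_one, one_mul,
      Algebra.algebraMap_eq_smul_one, TensorProduct.smul_tmul]⟩
  have : Nontrivial V := IsSimpleModule.nontrivial (k ⊗[k₀] A₀) V
  obtain ⟨ψ, hψ, hψ'⟩ := exists_semilinear_addEquiv hsplit φ V fun W hW hne ↦ by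
    let W' : Submodule (k ⊗[k₀] A₀) V :=
      { W.toAddSubmonoid with
        smul_mem' := fun a w hw ↦ by
          change a • w ∈ W
          induction a with
          | zero => rw [zero_smul]; exact W.zero_mem
          | tmul c a => rw [htmul]; exact W.smul_mem _ (hW _ _ hw)
          | add x y hx hy => rw [add_smul]; exact W.add_mem hx hy }
    have hmem (v : V) : v ∈ W' ↔ v ∈ W := Iff.rfl
    rcases eq_bot_or_eq_top W' with h | h
    · exact absurd ((Submodule.eq_bot_iff W).mpr fun v hv ↦
        (Submodule.eq_bot_iff W').mp h v hv) hne
    · exact eq_top_iff.mpr fun v _ ↦ (hmem v).mp (h ▸ Submodule.mem_top)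
  refine ⟨ψ, fun a v ↦ ?_⟩
  induction a with
  | zero => simp
  | tmul c a => rw [htmul, hψ, hψ', Algebra.TensorProduct.congr_apply,
      Algebra.TensorProduct.map_tmul, htmul]; rfl
  | add x y hx hy => rw [add_smul, map_add, map_add, add_smul, hx, hy]

open TensorProduct in
/-- The twist of `k ⊗ A₀` by an automorphism `σ` of `k` fixing `k₀` is `σ`-Morita equivalent to
`k ⊗ A₀`, if `A₀` is split over `k₀`. -/
theorem sigmaMoritaEquivalent_of_split [FiniteDimensional k₀ A₀] {k : Type u} [Field k]
    [Algebra k₀ k]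
    (hsplit : ∀ V : ModuleCat.{u} A₀, IsSimpleModule A₀ V →
      ∀ f : V →ₗ[A₀] V, ∃ c : k₀, ∀ v : V, f v = algebraMap k₀ A₀ c • v)
    (σ : k ≃+* k) (hσ : ∀ c : k₀, σ (algebraMap k₀ k c) = algebraMap k₀ k c) :
    SigmaMoritaEquivalent σ (k ⊗[k₀] A₀) := by
  let φ : k ≃ₐ[k₀] k := AlgEquiv.ofRingEquiv (f := σ) hσ
  let F : k ⊗[k₀] A₀ ≃ₐ[k₀] k ⊗[k₀] A₀ :=
    Algebra.TensorProduct.congr φ (AlgEquiv.refl : A₀ ≃ₐ[k₀] A₀)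
  let e : Twist σ (k ⊗[k₀] A₀) ≃ₐ[k] k ⊗[k₀] A₀ :=
    AlgEquiv.ofRingEquiv (f := (F.toRingEquiv : Twist σ (k ⊗[k₀] A₀) ≃+* k ⊗[k₀] A₀))
      fun c ↦ by
        change F (σ.symm c ⊗ₜ 1) = c ⊗ₜ 1
        rw [Algebra.TensorProduct.congr_apply, Algebra.TensorProduct.map_tmul]
        change σ (σ.symm c) ⊗ₜ _ = _
        simp
  refine ⟨ModuleCat.restrictScalarsEquivalenceOfRingEquiv e.toRingEquiv, inferInstance,
    ModuleCat.Algebra.restrictScalarsEquivalenceOfRingEquiv_linear e, fun V hV ↦ ?_⟩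
  obtain ⟨ψ, hψ⟩ := exists_addEquiv_map_smul hsplit φ V
  exact ⟨(LinearEquiv.toModuleIso (X₁ := (mtwistObj σ V))
    (X₂ := (ModuleCat.restrictScalars e.toRingEquiv.toRingHom).obj V)
    { ψ with map_smul' := hψ }).symm⟩

end SplitAlgebra

/-- Let `k = 𝔽̄_p` with Frobenius `σ`, let `k₀` be the subfield with `p^m` elements and let
`A₀` be a finite-dimensional `k₀`-algebra which is split over `k₀` (the endomorphisms of every
simple `A₀`-module are the scalars `k₀`).  Then `A = k ⊗_{k₀} A₀` and `A^{σ^m}` are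
`σ^m`-Morita equivalent; in particular, the `σ`-Morita Frobenius number of `A` is at most
`m`. -/
theorem sigmaMoritaFrobeniusNumber_le_of_form
    (p : ℕ) [Fact p.Prime] (k : Type u) [Field k] [Algebra (ZMod p) k]
    [IsAlgClosure (ZMod p) k] [IsAlgClosed k] [CharP k p]
    (m : ℕ) (hm : 0 < m)
    (k₀ : Type u) [Field k₀] [Fintype k₀] [Algebra k₀ k] (hcard : Fintype.card k₀ = p ^ m)
    (A₀ : Type u) [Ring A₀] [Algebra k₀ A₀] [FiniteDimensional k₀ A₀]
    (hsplit : ∀ V : ModuleCat.{u} A₀, IsSimpleModule A₀ V →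
      ∀ f : V →ₗ[A₀] V, ∃ c : k₀, ∀ v : V, f v = algebraMap k₀ A₀ c • v) :
    SigmaMoritaEquivalent
        (((frobeniusEquiv k p : RingAut k) ^ m : RingAut k) : k ≃+* k)
        (TensorProduct k₀ k A₀) ∧
      SigmaMoritaFrobeniusNumber p k (TensorProduct k₀ k A₀) ≤ m := by
  have hmor : SigmaMoritaEquivalent
      (((frobeniusEquiv k p : RingAut k) ^ m : RingAut k) : k ≃+* k)
      (TensorProduct k₀ k A₀) := by
    refine sigmaMoritaEquivalent_of_split hsplit _ fun c ↦ ?_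
    have hpow (n : ℕ) (x : k) : ((frobeniusEquiv k p : RingAut k) ^ n) x = x ^ p ^ n := by
      induction n with
      | zero => simp
      | succ n ih =>
        rw [pow_succ', RingAut.mul_apply, ih, pow_succ, pow_mul]
        rfl
    rw [hpow, ← map_pow, ← hcard, FiniteField.pow_card]
  exact ⟨hmor, Nat.sInf_le ⟨hm, hmor⟩⟩
end
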